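/- Fix real parameters a > 0 and b ∈ (0,1). Let u = (u₁, u₂) : ℝ → ℝ² be the solution of the affine system ẋ = y + a, ẏ = −x + 2by with u(0) = (0,0). Then there exists T > 0 such that u₂(T) = 0, u₂(t) < 0 for all t ∈ (0,T), and x_d := u₁(T) < 0. Moreover, with Γ¹ = {u(t) : t ∈ [0,T]}, Γ² = [x_d, 0] × {0}, and Γ₀ = Γ¹ ∪ Γ², and denoting by Γ_ε the unique attracting periodic orbit of the Le Corbeiller system in a fixed sufficiently large ball (which exists for all small ε > 0), the Hausdorff distance between Γ_ε and Γ₀ tends to 0 as ε → 0⁺. -/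

import Mathlib

/-- The vector field of the Le Corbeiller system. -/
noncomputable def corbeillerField (a b ε : ℝ) (p : ℝ × ℝ) : ℝ × ℝ :=
  (p.2 + a, -p.1 + b * p.2 * (2 - Real.exp (p.2 / ε)))

/-- `p` is a nonconstant periodic solution of the planar ODE with vector field `f`. -/
def IsPeriodicSol (f : ℝ × ℝ → ℝ × ℝ) (p : ℝ → ℝ × ℝ) : Prop :=
  (∀ t : ℝ, HasDerivAt p (f (p t)) t) ∧
  (∃ T > (0 : ℝ), ∀ t : ℝ, p (t + T) = p t) ∧
  (∃ t₁ t₂ : ℝ, p t₁ ≠ p t₂)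

namespace Corbeiller

open Set Filter Topology

/-- The nonlinear damping term of the Le Corbeiller system. -/
noncomputable def damp (b ε y : ℝ) : ℝ := b * y * (2 - Real.exp (y / ε))

lemma damp_zero (b ε : ℝ) : damp b ε 0 = 0 := by simp [damp]

lemma hasDerivAt_damp (b ε y : ℝ) :
    HasDerivAt (damp b ε) (b * (2 - Real.exp (y / ε) * (1 + y / ε))) y := by
  have h1 : HasDerivAt (fun y : ℝ => Real.exp (y / ε)) (Real.exp (y / ε) * (1 / ε)) y :=
    ((hasDerivAt_id y).div_const ε).exp
  have h2 := ((hasDerivAt_id y).const_mul b).mul (h1.const_sub 2)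
  refine h2.congr_deriv ?_
  simp only [id]
  ring

lemma neg_one_le_exp_mul (v : ℝ) : -1 ≤ Real.exp v * (1 + v) := by
  have h1 := Real.add_one_le_exp (-v)
  have h2 : Real.exp v * Real.exp (-v) = 1 := by rw [← Real.exp_add]; simp
  nlinarith [Real.exp_pos v]

section

variable {b ε y z : ℝ}

lemma damp_le (hb : 0 < b) (hε : 0 < ε) (y : ℝ) : damp b ε y ≤ b * ε := by
  have hy : y = ε * (y / ε) := by field_simp
  have h1 := Real.add_one_le_exp (y / ε)
  have h3 : damp b ε y = b * ε * (y / ε * (2 - Real.exp (y / ε))) := by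
    rw [damp]; nth_rw 1 [hy]; ring
  have h2 : y / ε * (2 - Real.exp (y / ε)) ≤ 1 := by
    rcases le_total 0 (y / ε) with h | h
    · have := mul_le_mul_of_nonneg_left (by linarith : 2 - Real.exp (y / ε) ≤ 1 - y / ε) h
      nlinarith [sq_nonneg (y / ε - 1 / 2)]
    · have : Real.exp (y / ε) ≤ 1 := Real.exp_le_one_iff.2 h
      nlinarith
  rw [h3]
  have : 0 < b * ε := by positivity
  nlinarith

lemma exp_div_le_one (hε : 0 < ε) (hy : y ≤ 0) : Real.exp (y / ε) ≤ 1 :=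
  Real.exp_le_one_iff.2 (div_nonpos_of_nonpos_of_nonneg hy hε.le)

lemma two_mul_le_damp (hb : 0 < b) (hy : y ≤ 0) : 2 * b * y ≤ damp b ε y := by
  have : 0 ≤ b * (-y) * Real.exp (y / ε) :=
    mul_nonneg (mul_nonneg hb.le (by linarith)) (Real.exp_pos _).le
  rw [damp]; nlinarith

lemma damp_le_two_mul_add (hb : 0 < b) (hε : 0 < ε) (y : ℝ) :
    damp b ε y ≤ 2 * b * y + b * ε := by
  have h1 := Real.add_one_le_exp (-(y / ε))
  have h2 : Real.exp (y / ε) * Real.exp (-(y / ε)) = 1 := by rw [← Real.exp_add]; simp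
  have h4 : -(y / ε) * Real.exp (y / ε) ≤ 1 := by nlinarith [Real.exp_pos (y / ε)]
  have hy : y = ε * (y / ε) := by field_simp
  have h3 : damp b ε y = 2 * b * y + b * ε * (-(y / ε) * Real.exp (y / ε)) := by
    rw [damp]
    have : b * ε * (-(y / ε) * Real.exp (y / ε)) = - b * (ε * (y / ε)) * Real.exp (y / ε) := by
      ring
    rw [this, ← hy]; ring
  rw [h3]
  have : 0 < b * ε := by positivity
  nlinarith

lemma damp_sub_le (hb : 0 < b) (hyz : y ≤ z) :
    damp b ε z - damp b ε y ≤ 3 * b * (z - y) := by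
  have : Monotone fun s => 3 * b * s - damp b ε s := by
    apply monotone_of_hasDerivAt_nonneg
      (fun s => ((hasDerivAt_id s).const_mul (3 * b)).sub (hasDerivAt_damp b ε s))
    intro s
    have := neg_one_le_exp_mul (s / ε)
    simp only [Pi.zero_apply]
    nlinarith
  have := this hyz
  simp only at this
  linarith

lemma le_damp_sub (hb : 0 < b) (hε : 0 < ε) (hyz : y ≤ z) (hz : z ≤ 0) :
    b * (z - y) ≤ damp b ε z - damp b ε y := by
  have h1 : Real.exp (y / ε) ≤ Real.exp (z / ε) :=
    Real.exp_le_exp.2 (div_le_div_of_nonneg_right hyz hε.le)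
  have h2 := exp_div_le_one hε hz
  have h3 : (-z) * (1 - Real.exp (z / ε)) ≤ (-y) * (1 - Real.exp (y / ε)) :=
    mul_le_mul (by linarith) (by linarith) (by linarith) (by linarith)
  rw [damp, damp]
  nlinarith

lemma neg_le_damp {η K : ℝ} (hb : 0 < b) (hε : 0 < ε) (hK : 0 ≤ K) (hη : damp b ε η = -K)
    (hy : 0 ≤ y) (hyη : y ≤ η) : -K ≤ damp b ε y := by
  rcases le_total (Real.exp (y / ε)) 2 with h | h
  · have : 0 ≤ damp b ε y := mul_nonneg (mul_nonneg hb.le hy) (by linarith)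
    linarith
  · rw [← hη, damp, damp]
    have h1 : Real.exp (y / ε) ≤ Real.exp (η / ε) :=
      Real.exp_le_exp.2 (div_le_div_of_nonneg_right hyη hε.le)
    have h3 : y * (Real.exp (y / ε) - 2) ≤ η * (Real.exp (η / ε) - 2) :=
      mul_le_mul hyη (by linarith) (by linarith) (by linarith)
    nlinarith

lemma exists_damp_eq {K h : ℝ} (hb : 0 < b) (hK : 0 < K) (hh : 0 < h) :
    ∃ ε₁ > 0, ∀ ε ∈ Ioo 0 ε₁, ∃ η ∈ Ioc 0 h, damp b ε η = -K := by
  refine ⟨h / (1 + K / (b * h)), by positivity, fun ε hε => ?_⟩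
  have hε0 := hε.1
  have h1 : damp b ε h ≤ -K := by
    have h2 : ε * (1 + K / (b * h)) < h := (lt_div_iff₀ (by positivity)).1 hε.2
    have h3 : 1 + K / (b * h) < h / ε := by rw [lt_div_iff₀ hε0]; linarith
    have h4 := Real.add_one_le_exp (h / ε)
    have h5 : K = b * h * (K / (b * h)) := by field_simp
    have h6 : 0 < b * h := by positivity
    rw [damp]
    rw [h5]
    nlinarith
  have hc : ContinuousOn (damp b ε) (Icc 0 h) := fun y _ =>
    (hasDerivAt_damp b ε y).continuousAt.continuousWithinAt
  have := intermediate_value_Icc' hh.le hc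
  obtain ⟨η, hη, hη'⟩ := this ⟨h1, by rw [damp_zero]; linarith⟩
  refine ⟨η, ⟨lt_of_le_of_ne hη.1 ?_, hη.2⟩, hη'⟩
  rintro rfl
  rw [damp_zero] at hη'
  linarith

/-- Numerator of the difference of the slopes `(-x + damp y) / (y + a)` at two heights. -/
lemma slope_num_le {a x y₁ y₂ : ℝ} (ha : 0 < a) (hb : 0 < b) (hε : 0 < ε) (hx : x ≤ 0)
    (h₁ : -(a / 2) ≤ y₁) (h₁₂ : y₁ ≤ y₂) :
    (-x + damp b ε y₂) * (y₁ + a) - (-x + damp b ε y₁) * (y₂ + a) ≤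
      3 * a * b * (y₂ - y₁) := by
  have he : Real.exp (y₁ / ε) ≤ Real.exp (y₂ / ε) :=
    Real.exp_le_exp.2 (div_le_div_of_nonneg_right h₁₂ hε.le)
  have e1 := Real.exp_pos (y₁ / ε)
  have e2 := Real.exp_pos (y₂ / ε)
  have key : (-x + damp b ε y₂) * (y₁ + a) - (-x + damp b ε y₁) * (y₂ + a)
      = x * (y₂ - y₁) + a * (damp b ε y₂ - damp b ε y₁)
        - b * (y₁ * y₂ * (Real.exp (y₂ / ε) - Real.exp (y₁ / ε))) := by
    simp only [damp]; ring
  have hx' : x * (y₂ - y₁) ≤ 0 := mul_nonpos_of_nonpos_of_nonneg hx (by linarith)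
  have hd := damp_sub_le (ε := ε) hb h₁₂
  by_cases hs : 0 ≤ y₁ * y₂
  · have : 0 ≤ b * (y₁ * y₂ * (Real.exp (y₂ / ε) - Real.exp (y₁ / ε))) :=
      mul_nonneg hb.le (mul_nonneg hs (by linarith))
    rw [key]; nlinarith
  · have hy1 : y₁ < 0 := by
      by_contra h
      push Not at h
      exact hs (mul_nonneg h (by linarith))
    have hy2 : 0 < y₂ := by
      by_contra h
      push Not at h
      exact hs (mul_nonneg_of_nonpos_of_nonpos hy1.le h)
    have h3 : a * (damp b ε y₂ - damp b ε y₁)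
        = 2 * a * b * (y₂ - y₁) - a * b * (y₂ * Real.exp (y₂ / ε))
          + a * b * (y₁ * Real.exp (y₁ / ε)) := by simp only [damp]; ring
    have h4 : a * b * (y₁ * Real.exp (y₁ / ε)) ≤ 0 :=
      mul_nonpos_of_nonneg_of_nonpos (by positivity) (mul_nonpos_of_nonpos_of_nonneg hy1.le e1.le)
    have h5 : -(y₁ * y₂ * (Real.exp (y₂ / ε) - Real.exp (y₁ / ε))) ≤
        a * (y₂ * Real.exp (y₂ / ε)) := by
      have i1 : -(y₁ * y₂ * (Real.exp (y₂ / ε) - Real.exp (y₁ / ε))) =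
        (-y₁) * (y₂ * (Real.exp (y₂ / ε) - Real.exp (y₁ / ε))) := by ring
      rw [i1]
      apply mul_le_mul (by linarith) _ _ ha.le
      · exact mul_le_mul_of_nonneg_left (by linarith) hy2.le
      · exact mul_nonneg hy2.le (by linarith)
    have h6 := mul_le_mul_of_nonneg_left h5 hb.le
    have h7 : 0 ≤ a * b * (y₂ - y₁) := mul_nonneg (by positivity) (by linarith)
    rw [key, h3]
    linarith

lemma slope_num_le_of_le {a x y₁ y₂ V : ℝ} (ha : 0 < a) (hb : 0 < b) (hε : 0 < ε) (hx : x ≤ 0)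
    (hV : 0 ≤ V) (h₁ : ε * V ≤ y₁) (h₁₂ : y₁ ≤ y₂) :
    (-x + damp b ε y₂) * (y₁ + a) - (-x + damp b ε y₁) * (y₂ + a) ≤
      -(a * b * (Real.exp V - 2)) * (y₂ - y₁) := by
  have he : Real.exp (y₁ / ε) ≤ Real.exp (y₂ / ε) :=
    Real.exp_le_exp.2 (div_le_div_of_nonneg_right h₁₂ hε.le)
  have hy1 : 0 ≤ y₁ := le_trans (by positivity) h₁
  have hV1 : Real.exp V ≤ Real.exp (y₁ / ε) := by
    apply Real.exp_le_exp.2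
    rw [le_div_iff₀ hε]; linarith
  have key : (-x + damp b ε y₂) * (y₁ + a) - (-x + damp b ε y₁) * (y₂ + a)
      = x * (y₂ - y₁) + a * b * 2 * (y₂ - y₁)
        - a * b * (y₂ * Real.exp (y₂ / ε) - y₁ * Real.exp (y₁ / ε))
        - b * (y₁ * y₂ * (Real.exp (y₂ / ε) - Real.exp (y₁ / ε))) := by
    simp only [damp]; ring
  have hx' : x * (y₂ - y₁) ≤ 0 := mul_nonpos_of_nonpos_of_nonneg hx (by linarith)
  have h2 : 0 ≤ b * (y₁ * y₂ * (Real.exp (y₂ / ε) - Real.exp (y₁ / ε))) :=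
    mul_nonneg hb.le (mul_nonneg (mul_nonneg hy1 (by linarith)) (by linarith))
  have h3 : Real.exp V * (y₂ - y₁) ≤ y₂ * Real.exp (y₂ / ε) - y₁ * Real.exp (y₁ / ε) := by
    have i1 := mul_le_mul_of_nonneg_left he (by linarith : 0 ≤ y₂)
    have i2 := mul_le_mul_of_nonneg_right hV1 (by linarith : 0 ≤ y₂ - y₁)
    nlinarith
  have h4 := mul_le_mul_of_nonneg_left h3 (by positivity : 0 ≤ a * b)
  rw [key]
  nlinarith

end

/-- Derivative of the damping term, frozen above height `η`. -/
noncomputable def cutoffDeriv (b ε η s : ℝ) : ℝ :=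
  b * (2 - Real.exp (min s η / ε) * (1 + min s η / ε))

/-- A `C¹`, globally Lipschitz function that agrees with the damping term below `η`. -/
structure IsCutoff (b ε η K : ℝ) (G : ℝ → ℝ) : Prop where
  contDiff : ContDiff ℝ 1 G
  lipschitz : ∃ L, LipschitzWith L G
  eq_damp : ∀ y ≤ η, G y = damp b ε y
  le_neg : ∀ y, η ≤ y → G y ≤ -K
  sub_le : ∀ y z, y ≤ z → G z - G y ≤ 3 * b * (z - y)

lemma exists_isCutoff {b ε η K : ℝ} (hb : 0 < b) (hε : 0 < ε) (hη : 0 < η) (hK : 0 < K)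
    (h : damp b ε η = -K) : ∃ G, IsCutoff b ε η K G := by
  have hc : Continuous (cutoffDeriv b ε η) := by
    unfold cutoffDeriv
    fun_prop
  let G : ℝ → ℝ := fun y => ∫ s in (0 : ℝ)..y, cutoffDeriv b ε η s
  have hG : ∀ y, HasDerivAt G (cutoffDeriv b ε η y) y := fun y =>
    intervalIntegral.integral_hasDerivAt_right (hc.intervalIntegrable _ _)
      hc.stronglyMeasurable.stronglyMeasurableAtFilter hc.continuousAt
  have hd : deriv G = cutoffDeriv b ε η := funext fun y => (hG y).deriv
  have hle : ∀ y, cutoffDeriv b ε η y ≤ 3 * b := fun y => by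
    have := neg_one_le_exp_mul (min y η / ε)
    rw [cutoffDeriv]
    nlinarith
  have heq : ∀ y ≤ η, G y = damp b ε y := by
    have h0 : ∀ y ∈ Iic η, HasDerivWithinAt (fun y => G y - damp b ε y) 0 (Iic η) y := by
      intro y hy
      refine ((hG y).sub (hasDerivAt_damp b ε y)).hasDerivWithinAt.congr_deriv ?_
      rw [cutoffDeriv, min_eq_left hy, sub_self]
    intro y hy
    have := (convex_Iic η).is_const_of_fderivWithin_eq_zero (𝕜 := ℝ)
      (fun y hy => (h0 y hy).differentiableWithinAt) (f := fun y => G y - damp b ε y)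
      (fun y hy => by
        have := (h0 y hy).hasFDerivWithinAt.fderivWithin
          (uniqueDiffOn_Iic η y hy)
        rw [this]; ext; simp) hy (mem_Iic.2 hη.le)
    have h1 : G 0 = 0 := by simp [G]
    simp only [h1, damp_zero, sub_zero] at this
    linarith
  refine ⟨G, ?_, ?_, heq, ?_, ?_⟩
  · exact contDiff_one_iff_deriv.2 ⟨fun y => (hG y).differentiableAt, hd ▸ hc⟩
  · set V := η / ε with hV
    have hV0 : 0 < V := by positivity
    refine ⟨(b * (2 + Real.exp V * (1 + V))).toNNReal,
      lipschitzWith_of_nnnorm_deriv_le (fun y => (hG y).differentiableAt) fun y => ?_⟩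
    rw [← NNReal.coe_le_coe, coe_nnnorm, hd, Real.coe_toNNReal _ (by positivity)]
    have h1 := neg_one_le_exp_mul (min y η / ε)
    have h2 : min y η / ε ≤ V := div_le_div_of_nonneg_right (min_le_right _ _) hε.le
    have h3 : Real.exp (min y η / ε) * (1 + min y η / ε) ≤ Real.exp V * (1 + V) := by
      have h4 := Real.exp_le_exp.2 h2
      have h5 := Real.exp_pos (min y η / ε)
      nlinarith
    have h4 : 1 ≤ Real.exp V := Real.one_le_exp hV0.le
    rw [cutoffDeriv, Real.norm_eq_abs, abs_mul, abs_of_pos hb]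
    refine mul_le_mul_of_nonneg_left ?_ hb.le
    rw [abs_le]
    constructor <;> nlinarith
  · intro y hy
    have hanti : AntitoneOn G (Ici η) := by
      refine antitoneOn_of_deriv_nonpos (convex_Ici η)
        (fun y _ => (hG y).continuousAt.continuousWithinAt)
        (fun y _ => (hG y).differentiableAt.differentiableWithinAt) fun y hy => ?_
      rw [interior_Ici] at hy
      rw [hd, cutoffDeriv, min_eq_right (le_of_lt hy)]
      have h2 : 2 < Real.exp (η / ε) := by
        by_contra hcon
        push Not at hcon
        have : 0 ≤ damp b ε η := mul_nonneg (mul_nonneg hb.le hη.le) (by linarith)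
        linarith
      have h3 : 0 < η / ε := by positivity
      exact mul_nonpos_of_nonneg_of_nonpos hb.le (by nlinarith)
    have := hanti (mem_Ici.2 le_rfl) (mem_Ici.2 hy) hy
    rw [heq η le_rfl, h] at this
    exact this
  · intro y z hyz
    have : Monotone fun s => 3 * b * s - G s :=
      monotone_of_hasDerivAt_nonneg (fun s => ((hasDerivAt_id s).const_mul (3 * b)).sub (hG s))
        (fun s => by
          have := hle s
          simp only [Pi.zero_apply]
          linarith)
    have := this hyz
    simp only at this
    linarith

/-- `p` solves `ẋ = y + a, ẏ = -x + G y`. -/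
def IsSol (a : ℝ) (G : ℝ → ℝ) (p : ℝ → ℝ × ℝ) : Prop :=
  ∀ t, HasDerivAt p ((p t).2 + a, -(p t).1 + G (p t).2) t

lemma IsSol.fst {a : ℝ} {G : ℝ → ℝ} {p : ℝ → ℝ × ℝ} (h : IsSol a G p) (t : ℝ) :
    HasDerivAt (fun s => (p s).1) ((p t).2 + a) t :=
  (hasFDerivAt_fst (𝕜 := ℝ) (p := p t)).comp_hasDerivAt t (h t)

lemma IsSol.snd {a : ℝ} {G : ℝ → ℝ} {p : ℝ → ℝ × ℝ} (h : IsSol a G p) (t : ℝ) :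
    HasDerivAt (fun s => (p s).2) (-(p t).1 + G (p t).2) t :=
  (hasFDerivAt_snd (𝕜 := ℝ) (p := p t)).comp_hasDerivAt t (h t)

lemma IsSol.continuous {a : ℝ} {G : ℝ → ℝ} {p : ℝ → ℝ × ℝ} (h : IsSol a G p) :
    Continuous p :=
  continuous_iff_continuousAt.2 fun t => (h t).continuousAt

lemma IsSol.comp_add {a : ℝ} {G : ℝ → ℝ} {p : ℝ → ℝ × ℝ} (h : IsSol a G p) (s : ℝ) :
    IsSol a G fun t => p (t + s) := fun t => (h (t + s)).comp_add_const t s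

lemma lipschitzWith_field (a : ℝ) {G : ℝ → ℝ} {L : NNReal} (hG : LipschitzWith L G) :
    LipschitzWith (1 + L) fun q : ℝ × ℝ => (q.2 + a, -q.1 + G q.2) := by
  refine (LipschitzWith.of_dist_le_mul fun q q' => ?_)
  have h2 := (hG.dist_le_mul q.2 q'.2)
  have h3 : dist q.1 q'.1 ≤ dist q q' := le_max_left _ _
  have h4 : dist q.2 q'.2 ≤ dist q q' := le_max_right _ _
  have h5 : (L : ℝ) * dist q.2 q'.2 ≤ L * dist q q' := mul_le_mul_of_nonneg_left h4 L.2
  have h6 : 0 ≤ (L : ℝ) * dist q q' := mul_nonneg L.2 dist_nonneg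
  rw [Prod.dist_eq]
  push_cast
  refine max_le ?_ ?_
  · simp only [Real.dist_eq] at *
    have : q.2 + a - (q'.2 + a) = q.2 - q'.2 := by ring
    rw [this]; linarith
  · simp only [Real.dist_eq] at *
    have : -q.1 + G q.2 - (-q'.1 + G q'.2) = -(q.1 - q'.1) + (G q.2 - G q'.2) := by ring
    rw [this]
    refine (abs_add_le _ _).trans ?_
    rw [abs_neg]; linarith

lemma IsSol.eq {a : ℝ} {G : ℝ → ℝ} {L : NNReal} (hG : LipschitzWith L G) {p q : ℝ → ℝ × ℝ}
    (hp : IsSol a G p) (hq : IsSol a G q) {t₀ : ℝ} (h : p t₀ = q t₀) : p = q :=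
  ODE_solution_unique_univ (v := fun _ z => (z.2 + a, -z.1 + G z.2)) (s := fun _ => univ)
    (fun _ => (lipschitzWith_field a hG).lipschitzOnWith)
    (fun t => ⟨hp t, trivial⟩) (fun t => ⟨hq t, trivial⟩) h

open scoped Manifold ContDiff in
lemma exists_global_solution {E : Type*} [NormedAddCommGroup E] [NormedSpace ℝ E]
    [CompleteSpace E] {v : E → E} (hv : ContDiff ℝ 1 v) {L : NNReal} (hL : LipschitzWith L v)
    (x₀ : E) : ∃ γ : ℝ → E, γ 0 = x₀ ∧ ∀ t, HasDerivAt γ (v (γ t)) t := by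
  set h : ℝ := 1 / (2 * (L + 1)) with hh
  have hL0 : (0 : ℝ) ≤ L := L.2
  have hh0 : 0 < h := by positivity
  have loc : ∀ x : E, ∃ γ : ℝ → E, γ 0 = x ∧
      IsMIntegralCurveOn γ (I := 𝓘(ℝ, E)) (v : (x : E) → TangentSpace 𝓘(ℝ, E) x) (Ioo (-h) h) := by
    intro x
    let R : NNReal := ‖v x‖₊ + 1
    have hpl : IsPicardLindelof (fun _ : ℝ => v) (tmin := -h) (tmax := h)
        ⟨0, by constructor <;> linarith⟩ x R 0 (‖v x‖₊ + L * R) L := by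
      refine ⟨fun _ _ => hL.lipschitzOnWith, fun _ _ => continuousOn_const, fun _ _ y hy => ?_, ?_⟩
      · have h1 := hL.dist_le_mul y x
        rw [dist_eq_norm] at h1
        have h2 : dist y x ≤ R := hy
        have h3 : ‖v y‖ ≤ ‖v x‖ + ‖v y - v x‖ := by
          have := norm_add_le (v x) (v y - v x)
          simpa using this
        have h4 : (L : ℝ) * dist y x ≤ L * R := mul_le_mul_of_nonneg_left h2 hL0
        push_cast
        linarith
      · have h1 : max (h - 0) (0 - -h) = h := by simp
        push_cast
        change (‖v x‖ + L * R) * max (h - 0) (0 - -h) ≤ R - 0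
        rw [h1, hh, mul_one_div, div_le_iff₀ (by positivity)]
        have : (R : ℝ) = ‖v x‖ + 1 := by simp [R]
        rw [this]
        nlinarith [norm_nonneg (v x), mul_nonneg hL0 (norm_nonneg (v x))]
    obtain ⟨γ, hγ0, hγ⟩ := hpl.exists_eq_forall_mem_Icc_hasDerivWithinAt₀
    refine ⟨γ, hγ0, fun t ht => ?_⟩
    have := ((hγ t (Ioo_subset_Icc_self ht)).mono Ioo_subset_Icc_self)
    exact this.hasFDerivWithinAt.hasMFDerivWithinAt
  obtain ⟨γ, h0, hγ⟩ := exists_isMIntegralCurve_of_isMIntegralCurveOn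
    (I := 𝓘(ℝ, E)) (contMDiff_vectorSpace_iff_contDiff.2 hv) hh0 loc x₀
  refine ⟨γ, h0, fun t => ?_⟩
  have h1 : HasFDerivAt γ ((1 : ℝ →L[ℝ] ℝ).smulRight (v (γ t))) t := (hγ t).hasFDerivAt
  simpa using h1.hasDerivAt

lemma exists_isSol (a : ℝ) {b ε η K : ℝ} {G : ℝ → ℝ} (hG : IsCutoff b ε η K G) (z : ℝ × ℝ) :
    ∃ p, p 0 = z ∧ IsSol a G p := by
  obtain ⟨L, hL⟩ := hG.lipschitz
  have := hG.contDiff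
  exact exists_global_solution (v := fun q : ℝ × ℝ => (q.2 + a, -q.1 + G q.2))
    (by fun_prop) (lipschitzWith_field a hL) z

lemma linear_orbit_eq {a b : ℝ} (hb : b ∈ Ioo (0 : ℝ) 1) {u : ℝ → ℝ × ℝ}
    (hu : IsSol a (fun y => 2 * b * y) u) (hu0 : u 0 = (0, 0)) :
    ∃ w > 0,
      (∀ t, HasDerivAt (fun s => (u s).2) (-(a / w * Real.exp (b * t) * Real.sin (w * t))) t) ∧
      (∀ t, (u t).1 = 2 * b * (u t).2 + a / w * Real.exp (b * t) * Real.sin (w * t)) ∧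
      (u (2 * Real.pi / w)).2 = a * (Real.exp (b * (2 * Real.pi / w)) - 1) := by
  have hb2 : 0 < 1 - b ^ 2 := by nlinarith [hb.1, hb.2]
  set w := Real.sqrt (1 - b ^ 2) with hw
  have hw0 : 0 < w := Real.sqrt_pos.2 hb2
  have hw2 : w ^ 2 = 1 - b ^ 2 := Real.sq_sqrt hb2.le
  let Y : ℝ → ℝ := fun t =>
    a * (Real.exp (b * t) * (Real.cos (w * t) - b / w * Real.sin (w * t))) - a
  let S : ℝ → ℝ := fun t => a / w * (Real.exp (b * t) * Real.sin (w * t))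
  have he : ∀ t, HasDerivAt (fun t => Real.exp (b * t)) (Real.exp (b * t) * b) t := fun t => by
    simpa using ((hasDerivAt_id t).const_mul b).exp
  have hc : ∀ t, HasDerivAt (fun t => Real.cos (w * t)) (-Real.sin (w * t) * w) t := fun t => by
    simpa using ((hasDerivAt_id t).const_mul w).cos
  have hs : ∀ t, HasDerivAt (fun t => Real.sin (w * t)) (Real.cos (w * t) * w) t := fun t => by
    simpa using ((hasDerivAt_id t).const_mul w).sin
  have hY : ∀ t, HasDerivAt Y (-S t) t := fun t => by
    refine ((((he t).mul ((hc t).sub ((hs t).const_mul (b / w)))).const_mul a).sub_const a).congr_deriv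
      ?_
    simp only [S]
    simp only [Pi.sub_apply]
    field_simp
    linear_combination (-a * Real.sin (t * w)) * hw2
  have hS : ∀ t, HasDerivAt S (2 * b * S t + (Y t + a)) t := fun t => by
    refine (((he t).mul (hs t)).const_mul (a / w)).congr_deriv ?_
    simp only [S, Y]
    field_simp
    ring
  have hsol : IsSol a (fun y => 2 * b * y) fun t => (2 * b * Y t + S t, Y t) := fun t => by
    refine ((((hY t).const_mul (2 * b)).add (hS t)).prodMk (hY t)).congr_deriv ?_
    ext <;> simp
  have hlip : LipschitzWith (Real.toNNReal (2 * b)) fun y : ℝ => 2 * b * y :=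
    LipschitzWith.of_dist_le_mul fun y z => by
      rw [Real.coe_toNNReal _ (by linarith [hb.1]), Real.dist_eq, Real.dist_eq, ← mul_sub, abs_mul,
        abs_of_pos (by linarith [hb.1])]
  have hueq := IsSol.eq hlip hu hsol (t₀ := 0) (by simp [hu0, Y, S])
  have hu2 : (fun t => (u t).2) = Y := by rw [hueq]
  refine ⟨w, hw0, fun t => ?_, fun t => ?_, ?_⟩
  · rw [hu2]
    refine (hY t).congr_deriv ?_
    simp only [S]; ring
  · rw [hueq]
    simp only [S]; ring
  · rw [hueq]
    have h1 : w * (2 * Real.pi / w) = 2 * Real.pi := by field_simp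
    simp only [Y, h1]
    simp
    ring

lemma linear_orbit_returns {a b : ℝ} (ha : 0 < a) (hb : b ∈ Ioo (0 : ℝ) 1) {u : ℝ → ℝ × ℝ}
    (hu : IsSol a (fun y => 2 * b * y) u) (hu0 : u 0 = (0, 0)) :
    ∃ T > 0, (u T).2 = 0 ∧ (∀ t ∈ Ioo 0 T, (u t).2 < 0) ∧ (u T).1 < 0 := by
  obtain ⟨w, hw, hd, hx, h2⟩ := linear_orbit_eq hb hu hu0
  have hpi := Real.pi_pos
  have hc : Continuous fun t => (u t).2 :=
    continuous_iff_continuousAt.2 fun t => (hd t).continuousAt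
  have hA : StrictAntiOn (fun t => (u t).2) (Icc 0 (Real.pi / w)) := by
    refine strictAntiOn_of_deriv_neg (convex_Icc _ _) hc.continuousOn fun t ht => ?_
    rw [interior_Icc] at ht
    rw [(hd t).deriv, neg_lt_zero]
    have : 0 < Real.sin (w * t) := Real.sin_pos_of_pos_of_lt_pi (mul_pos hw ht.1) (by
      have := (lt_div_iff₀ hw).1 ht.2; linarith)
    positivity
  have hsin : ∀ t ∈ Ioo (Real.pi / w) (2 * Real.pi / w), Real.sin (w * t) < 0 := fun t ht => by
    have h1 := (lt_div_iff₀ hw).1 ht.2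
    have h3 := (div_lt_iff₀ hw).1 ht.1
    have := Real.sin_neg_of_neg_of_neg_pi_lt (x := w * t - 2 * Real.pi) (by linarith) (by linarith)
    rwa [Real.sin_sub_two_pi] at this
  have hM : StrictMonoOn (fun t => (u t).2) (Icc (Real.pi / w) (2 * Real.pi / w)) := by
    refine strictMonoOn_of_deriv_pos (convex_Icc _ _) hc.continuousOn fun t ht => ?_
    rw [interior_Icc] at ht
    rw [(hd t).deriv]
    have : 0 < a / w * Real.exp (b * t) := by positivity
    nlinarith [hsin t ht]
  have hp0 : 0 < Real.pi / w := by positivity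
  have hp2 : Real.pi / w < 2 * Real.pi / w := div_lt_div_of_pos_right (by linarith) hw
  have hmid : (u (Real.pi / w)).2 < 0 := by
    have := hA (left_mem_Icc.2 hp0.le) (right_mem_Icc.2 hp0.le) hp0
    simpa [hu0] using this
  have hend : 0 < (u (2 * Real.pi / w)).2 := by
    rw [h2]
    have : 1 < Real.exp (b * (2 * Real.pi / w)) :=
      Real.one_lt_exp_iff.2 (mul_pos hb.1 (by positivity))
    exact mul_pos ha (by linarith)
  obtain ⟨T, hT, hT0⟩ := intermediate_value_Ioo hp2.le hc.continuousOn ⟨hmid, hend⟩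
  simp only at hT0
  refine ⟨T, by linarith [hT.1], hT0, fun t ht => ?_, ?_⟩
  · rcases le_or_gt t (Real.pi / w) with h | h
    · have := hA (left_mem_Icc.2 hp0.le) ⟨ht.1.le, h⟩ ht.1
      simpa [hu0] using this
    · have := hM ⟨h.le, by linarith [ht.2, hT.2]⟩ (Ioo_subset_Icc_self hT) ht.2
      simpa [hT0] using this
  · rw [hx, hT0]
    have : 0 < a / w * Real.exp (b * T) := by positivity
    nlinarith [hsin T hT]

section

lemma le_exp_mul_of_deriv_le {f f' : ℝ → ℝ} {C α β : ℝ} (hαβ : α ≤ β)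
    (hc : ContinuousOn f (Icc α β)) (hd : ∀ t ∈ Ioo α β, HasDerivAt f (f' t) t)
    (h : ∀ t ∈ Ioo α β, f' t ≤ C * f t) : f β ≤ Real.exp (C * (β - α)) * f α := by
  have he : ∀ t, HasDerivAt (fun t => Real.exp (-C * t)) (Real.exp (-C * t) * -C) t := fun t => by
    simpa using ((hasDerivAt_id t).const_mul (-C)).exp
  have hA : AntitoneOn (fun t => Real.exp (-C * t) * f t) (Icc α β) := by
    refine antitoneOn_of_deriv_nonpos (convex_Icc _ _)
      (ContinuousOn.mul (by fun_prop) hc) (fun t ht => ?_) fun t ht => ?_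
    · rw [interior_Icc] at ht
      exact ((he t).mul (hd t ht)).differentiableAt.differentiableWithinAt
    · rw [interior_Icc] at ht
      have hh := ((he t).mul (hd t ht)).deriv
      have h1 : deriv (fun t => Real.exp (-C * t) * f t) t =
        Real.exp (-C * t) * -C * f t + Real.exp (-C * t) * f' t := hh
      rw [h1]
      have h2 := h t ht
      have h3 := Real.exp_pos (-C * t)
      nlinarith
  have h1 := hA (left_mem_Icc.2 hαβ) (right_mem_Icc.2 hαβ) hαβ
  simp only at h1
  have h2 : Real.exp (C * β) * Real.exp (-C * β) = 1 := by rw [← Real.exp_add]; simp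
  have h3 : Real.exp (C * (β - α)) = Real.exp (C * β) * Real.exp (-C * α) := by
    rw [← Real.exp_add]; ring_nf
  calc f β = Real.exp (C * β) * (Real.exp (-C * β) * f β) := by rw [← mul_assoc, h2, one_mul]
    _ ≤ Real.exp (C * β) * (Real.exp (-C * α) * f α) :=
      mul_le_mul_of_nonneg_left h1 (Real.exp_pos _).le
    _ = _ := by rw [h3]; ring

variable {a b ε η K : ℝ} {G : ℝ → ℝ}

lemma IsCutoff.le (hb : 0 < b) (hε : 0 < ε) (hK : 0 ≤ K) (hG : IsCutoff b ε η K G) (y : ℝ) :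
    G y ≤ b * ε := by
  rcases le_total y η with h | h
  · rw [hG.eq_damp y h]; exact damp_le hb hε y
  · have := hG.le_neg y h
    have : 0 < b * ε := by positivity
    linarith

/-- Two solutions separate at most exponentially, at a rate that does not depend on `ε`. -/
lemma IsSol.sq_dist_le (hb : 0 < b) (hG : IsCutoff b ε η K G) {p q : ℝ → ℝ × ℝ}
    (hp : IsSol a G p) (hq : IsSol a G q) {t : ℝ} (ht : 0 ≤ t) :
    ((p t).1 - (q t).1) ^ 2 + ((p t).2 - (q t).2) ^ 2 ≤
      Real.exp (6 * b * t) * (((p 0).1 - (q 0).1) ^ 2 + ((p 0).2 - (q 0).2) ^ 2) := by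
  have hd := fun t => (((hp.fst t).fun_sub (hq.fst t)).fun_pow 2).fun_add
    (((hp.snd t).fun_sub (hq.snd t)).fun_pow 2)
  have := le_exp_mul_of_deriv_le (C := 6 * b) ht
    (fun t _ => (hd t).continuousAt.continuousWithinAt) (fun t _ => hd t) fun t _ => by
      have h1 : ∀ y z, (y - z) * (G y - G z) ≤ 3 * b * (y - z) ^ 2 := fun y z => by
        rcases le_total y z with h | h
        · nlinarith [hG.sub_le y z h]
        · nlinarith [hG.sub_le z y h]
      have h2 := h1 (p t).2 (q t).2
      have h3 := mul_nonneg hb.le (sq_nonneg ((p t).1 - (q t).1))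
      norm_num
      linarith
  simpa using this

lemma sub_mul_sub_le (hb : 0 < b) (hε : 0 < ε) (hη : 0 ≤ η) (hK : 0 ≤ K)
    (hG : IsCutoff b ε η K G) (y : ℝ) {w : ℝ} (hw : w ≤ 0) :
    (G y - 2 * b * w) * (y - w) ≤ 2 * b * (y - w) ^ 2 + b * ε * |y - w| := by
  rcases le_total w y with h | h
  · rw [abs_of_nonneg (sub_nonneg.2 h)]
    have : G y ≤ 2 * b * y + b * ε := by
      rcases le_total y η with h' | h'
      · rw [hG.eq_damp y h']; exact damp_le_two_mul_add hb hε y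
      · have := hG.le_neg y h'
        have : 0 < b * ε := by positivity
        have : 0 ≤ b * y := mul_nonneg hb.le (hη.trans h')
        linarith
    nlinarith
  · have h1 : 2 * b * y ≤ G y := by
      rw [hG.eq_damp y ((h.trans hw).trans hη)]
      exact two_mul_le_damp hb (h.trans hw)
    have : 0 ≤ b * ε * |y - w| := by positivity
    nlinarith

/-- Tracking of the regular arc of the singular cycle. -/
lemma IsSol.sq_dist_linear_le (hb : 0 < b) (hε : 0 < ε) (hη : 0 ≤ η) (hK : 0 ≤ K)
    (hG : IsCutoff b ε η K G) {p u : ℝ → ℝ × ℝ} (hp : IsSol a G p)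
    (hu : IsSol a (fun y => 2 * b * y) u) {t : ℝ} (ht : 0 ≤ t)
    (hu2 : ∀ s ∈ Ioo 0 t, (u s).2 ≤ 0) :
    ((p t).1 - (u t).1) ^ 2 + ((p t).2 - (u t).2) ^ 2 ≤
      Real.exp (5 * b * t) *
        (((p 0).1 - (u 0).1) ^ 2 + ((p 0).2 - (u 0).2) ^ 2 + ε ^ 2) := by
  have hd := fun t => ((((hp.fst t).fun_sub (hu.fst t)).fun_pow 2).fun_add
    (((hp.snd t).fun_sub (hu.snd t)).fun_pow 2)).add_const (ε ^ 2)
  have := le_exp_mul_of_deriv_le (C := 5 * b) ht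
    (fun t _ => (hd t).continuousAt.continuousWithinAt) (fun t _ => hd t) fun t ht => by
      have h2 := sub_mul_sub_le hb hε hη hK hG (p t).2 (hu2 t ht)
      have h3 := mul_nonneg hb.le (sq_nonneg ((p t).1 - (u t).1))
      have h4 := mul_nonneg hb.le (sq_nonneg (|(p t).2 - (u t).2| - ε))
      have h5 := sq_abs ((p t).2 - (u t).2)
      have h6 := mul_nonneg hb.le (sq_nonneg ε)
      have h7 : b * (|(p t).2 - (u t).2| - ε) ^ 2 =
          b * ((p t).2 - (u t).2) ^ 2 - 2 * (b * ε * |(p t).2 - (u t).2|) + b * ε ^ 2 := by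
        rw [← h5]; ring
      norm_num
      linarith
  simp only [sub_zero] at this
  nlinarith [sq_nonneg ε]

/-- Tracking of the sliding segment of the singular cycle. -/
lemma IsSol.sq_dist_sliding_le (hb : 0 < b) (hε : 0 < ε) (hη : 0 ≤ η) {D : ℝ} (hD : 0 ≤ D)
    (hK : D ≤ K) (hG : IsCutoff b ε η K G) {p : ℝ → ℝ × ℝ} (hp : IsSol a G p) {x₀ T t : ℝ}
    (ht : T ≤ t) (hx : ∀ s ∈ Ioo T t, x₀ + a * (s - T) ∈ Icc (-D) 0) :
    ((p t).1 - (x₀ + a * (t - T))) ^ 2 + (p t).2 ^ 2 ≤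
      Real.exp (4 * b * (t - T)) *
        (((p T).1 - x₀) ^ 2 + (p T).2 ^ 2 + η * (D + b * ε) / (2 * b)) := by
  set c := η * (D + b * ε) / (2 * b) with hc
  have hbc : b * c = η * (D + b * ε) / 2 := by rw [hc]; field_simp
  have hc0 : 0 ≤ c := by positivity
  have hxs : ∀ t, HasDerivAt (fun t => x₀ + a * (t - T)) a t := fun t => by
    simpa using (((hasDerivAt_id t).sub_const T).const_mul a).const_add x₀
  have hd := fun t => ((((hp.fst t).fun_sub (hxs t)).fun_pow 2).fun_add
    ((hp.snd t).fun_pow 2)).add_const c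
  have := le_exp_mul_of_deriv_le (C := 4 * b) ht
    (fun t _ => (hd t).continuousAt.continuousWithinAt) (fun t _ => hd t) fun t ht => by
      have hx' := hx t ht
      have h3 := mul_nonneg hb.le (sq_nonneg ((p t).1 - (x₀ + a * (t - T))))
      have key : (p t).2 * (-(x₀ + a * (t - T)) + G (p t).2) ≤
          2 * b * (p t).2 ^ 2 + η * (D + b * ε) := by
        set y := (p t).2
        set xs := x₀ + a * (t - T)
        have hby := mul_nonneg hb.le (sq_nonneg y)
        have h0 : 0 ≤ η * (D + b * ε) := by positivity
        rcases le_total y 0 with h | h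
        · have h1 : 2 * b * y ≤ G y := by
            rw [hG.eq_damp y (h.trans hη)]
            exact two_mul_le_damp hb h
          nlinarith [hx'.2]
        · rcases le_total y η with h' | h'
          · have h1 := hG.le hb hε (hD.trans hK) y
            have h2 : y * (-xs + G y) ≤ y * (D + b * ε) :=
              mul_le_mul_of_nonneg_left (by linarith [hx'.1]) h
            have h3 : y * (D + b * ε) ≤ η * (D + b * ε) :=
              mul_le_mul_of_nonneg_right h' (by positivity)
            linarith
          · have h1 := hG.le_neg y h'
            have h2 : y * (-xs + G y) ≤ 0 :=
              mul_nonpos_of_nonneg_of_nonpos h (by linarith [hx'.1])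
            linarith
      norm_num
      linarith
  simp only [sub_self, mul_zero, add_zero] at this
  linarith

end

section Barriers

variable {a b ε η K : ℝ} {G : ℝ → ℝ} {p : ℝ → ℝ × ℝ}

lemma IsSol.snd_le (hG : G η ≤ -K) (hp : IsSol a G p) {s t : ℝ} (hst : s ≤ t)
    (hs : (p s).2 ≤ η) (hx : ∀ r ∈ Ico s t, -K < (p r).1) : (p t).2 ≤ η :=
  image_le_of_deriv_right_lt_deriv_boundary' (B := fun _ => η) (B' := fun _ => 0)
    (fun r _ => (hp.snd r).continuousAt.continuousWithinAt)
    (fun r _ => (hp.snd r).hasDerivWithinAt) hs continuousOn_const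
    (fun r _ => hasDerivWithinAt_const _ _ _)
    (fun r hr h => by
      have h1 := hx r hr
      change (p r).2 = η at h
      rw [h]
      linarith) (right_mem_Icc.2 hst)

lemma IsSol.le_snd_of_linear (hp : IsSol a G p) {s t c m : ℝ} (hst : s ≤ t)
    (hs : c ≤ (p s).2)
    (hx : ∀ r ∈ Ico s t, m < -(p r).1 + G (c + m * (r - s))) :
    c + m * (t - s) ≤ (p t).2 := by
  have hB : ∀ r, HasDerivAt (fun r => -(c + m * (r - s))) (-m) r := fun r => by
    simpa using ((((hasDerivAt_id r).sub_const s).const_mul m).const_add c).fun_neg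
  have := image_le_of_deriv_right_lt_deriv_boundary' (f := fun r => -(p r).2)
    (fun r _ => (hp.snd r).fun_neg.continuousAt.continuousWithinAt)
    (fun r _ => (hp.snd r).fun_neg.hasDerivWithinAt)
    (by simpa using hs) (fun r _ => (hB r).continuousAt.continuousWithinAt)
    (fun r _ => (hB r).hasDerivWithinAt)
    (fun r hr h => by
      have h1 := hx r hr
      have h2 : (p r).2 = c + m * (r - s) := by linarith
      rw [h2]
      linarith) (right_mem_Icc.2 hst)
  linarith

lemma IsSol.le_snd (hp : IsSol a G p) {s t c : ℝ} (hst : s ≤ t) (hs : c ≤ (p s).2)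
    (hx : ∀ r ∈ Ico s t, (p r).1 < G c) : c ≤ (p t).2 := by
  simpa using hp.le_snd_of_linear (m := 0) hst hs
    fun r hr => by have := hx r hr; simp only [zero_mul, add_zero]; linarith

/-- While `y ≥ c`, the coordinate `x` grows at rate at least `c + a`. -/
lemma IsSol.mul_sub_le_fst_sub (hp : IsSol a G p) {s t c : ℝ} (hst : s ≤ t)
    (hy : ∀ r ∈ Ioo s t, c ≤ (p r).2) : (c + a) * (t - s) ≤ (p t).1 - (p s).1 :=
  (convex_Icc s t).mul_sub_le_image_sub_of_le_deriv
    (fun r _ => (hp.fst r).continuousAt.continuousWithinAt)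
    (fun r _ => (hp.fst r).differentiableAt.differentiableWithinAt)
    (fun r hr => by
      rw [interior_Icc] at hr
      rw [(hp.fst r).deriv]
      linarith [hy r hr]) s (left_mem_Icc.2 hst) t (right_mem_Icc.2 hst) hst

lemma exists_first_zero {f : ℝ → ℝ} (hf : Continuous f) {s t : ℝ} (hst : s ≤ t)
    (hs : f s ≤ 0) (ht : 0 ≤ f t) : ∃ τ ∈ Icc s t, f τ = 0 ∧ ∀ r ∈ Ico s τ, f r < 0 := by
  obtain ⟨τ, hτ, hmin⟩ := ((isCompact_Icc (a := s) (b := t)).inter_right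
    (isClosed_le continuous_const hf)).exists_isLeast ⟨t, right_mem_Icc.2 hst, ht⟩
  have hlt : ∀ r ∈ Ico s τ, f r < 0 := fun r hr => by
    by_contra hcon
    exact hr.2.not_ge (hmin ⟨⟨hr.1, hr.2.le.trans hτ.1.2⟩, not_lt.1 hcon⟩)
  refine ⟨τ, hτ.1, le_antisymm ?_ hτ.2, hlt⟩
  rcases hτ.1.1.eq_or_lt with h | h
  · rwa [← h]
  · have : closure (Ico s τ) ⊆ {r | f r ≤ 0} :=
      closure_minimal (fun r hr => (hlt r hr).le) (isClosed_le hf continuous_const)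
    rw [closure_Ico h.ne] at this
    exact this (right_mem_Icc.2 h.le)

/-- From the strip `0 ≤ y ≤ η` with `-K < x ≤ 0`, a solution flows to the section `x = 0`
without leaving the strip. -/
lemma IsSol.exists_reach (ha : 0 < a) (hη : 0 ≤ η) (hG : IsCutoff b ε η K G)
    (hp : IsSol a G p) {s : ℝ} (hx : (p s).1 ≤ 0) (hxK : -K < (p s).1) (hy : 0 ≤ (p s).2)
    (hyη : (p s).2 ≤ η) :
    ∃ τ, s ≤ τ ∧ τ ≤ s - (p s).1 / a ∧ (p τ).1 = 0 ∧
      ∀ t ∈ Icc s τ, (p t).1 ≤ 0 ∧ (p s).1 + a * (t - s) ≤ (p t).1 ∧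
        0 ≤ (p t).2 ∧ (p t).2 ≤ η := by
  have hG0 : G 0 = 0 := by rw [hG.eq_damp 0 hη, damp_zero]
  have hle : ∀ t, s ≤ t → (∀ r ∈ Ico s t, (p r).1 < 0) → 0 ≤ (p t).2 := fun t ht h =>
    hp.le_snd ht hy fun r hr => by rw [hG0]; exact h r hr
  have hgrow : ∀ t, s ≤ t → (∀ r ∈ Ico s t, (p r).1 < 0) → a * (t - s) ≤ (p t).1 - (p s).1 :=
    fun t ht h => by
      have := hp.mul_sub_le_fst_sub (c := 0) ht fun r hr =>
        hle r hr.1.le fun r' hr' => h r' ⟨hr'.1, hr'.2.trans hr.2⟩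
      simpa using this
  have hx0 : 0 ≤ -(p s).1 / a := div_nonneg (by linarith) ha.le
  obtain ⟨t₁, ht₁, ht₁0⟩ : ∃ t ∈ Icc s (s - (p s).1 / a), 0 ≤ (p t).1 := by
    by_contra! hcon
    have hs1 : s ≤ s - (p s).1 / a := by rw [neg_div] at hx0; linarith
    have h1 := hgrow _ hs1 fun r hr => hcon r ⟨hr.1, hr.2.le⟩
    have h2 := hcon _ (right_mem_Icc.2 hs1)
    have h3 : a * (s - (p s).1 / a - s) = -(p s).1 := by field_simp; ring
    linarith
  obtain ⟨τ, hτ, hτ0, hlt⟩ := exists_first_zero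
    (continuous_fst.comp hp.continuous) ht₁.1 hx ht₁0
  refine ⟨τ, hτ.1, hτ.2.trans ht₁.2, hτ0, fun t ht => ?_⟩
  have hlt' : ∀ r ∈ Ico s t, (p r).1 < 0 := fun r hr => hlt r ⟨hr.1, hr.2.trans_le ht.2⟩
  refine ⟨?_, by linarith [hgrow t ht.1 hlt'], hle t ht.1 hlt',
    hp.snd_le (hG.le_neg η le_rfl) ht.1 hyη fun r hr => ?_⟩
  · rcases ht.2.eq_or_lt with h | h
    · rw [h]; exact hτ0.le
    · exact (hlt t ⟨ht.1, h⟩).le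
  · have := hgrow r hr.1 fun r' hr' => hlt' r' ⟨hr'.1, hr'.2.trans hr.2⟩
    have := mul_nonneg ha.le (sub_nonneg.2 hr.1)
    linarith

end Barriers

/-- A regime of small parameters: `u` is the regular arc of the singular cycle, of duration `T`,
landing at `(-D, 0)`, and `ρ` bounds the error made when tracking the singular cycle. -/
structure Regime (a b D T M K V ρ ε η : ℝ) (G : ℝ → ℝ) (u : ℝ → ℝ × ℝ) : Prop where
  a_pos : 0 < a
  b_pos : 0 < b
  D_pos : 0 < D
  T_pos : 0 < T
  ε_pos : 0 < ε
  ε_le : ε ≤ 1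
  η_pos : 0 < η
  η_le : η ≤ ρ
  V_nonneg : 0 ≤ V
  ρ_le_a : ρ ≤ a / 2
  ρ_le_D : ρ ≤ D / 8
  ρ_lt : 8 * a * ρ + 2 * b * ρ * D < D ^ 2 / 2
  εV_le : ε * V ≤ ρ
  εV_exp_le : b * (ε * V * Real.exp V) ≤ D / 8
  lt_K : M + ρ < K
  cutoff : IsCutoff b ε η K G
  isSol : IsSol a (fun y => 2 * b * y) u
  zero_eq : u 0 = (0, 0)
  T_eq : u T = (-D, 0)
  snd_nonpos : ∀ t ∈ Icc 0 T, (u t).2 ≤ 0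
  abs_fst_le : ∀ t ∈ Icc 0 T, |(u t).1| ≤ M
  abs_snd_le : ∀ t ∈ Icc 0 T, |(u t).2| ≤ M
  error_le : Real.exp (5 * b * T) * (η ^ 2 + ε ^ 2) ≤ ρ ^ 2
  error_le' : Real.exp (4 * b * (D / a)) *
    (Real.exp (5 * b * T) * (η ^ 2 + ε ^ 2) + η * (D + b * ε) / (2 * b)) ≤ ρ ^ 2
  damp_eq : damp b ε η = -K
  two_le_exp : 2 ≤ Real.exp V
  contract : Real.exp (-(b * (Real.exp V - 2) * D / (8 * a))) * (Real.exp (48 * b * D / a) *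
    (2 * (1 + (2 * (2 * D + K + a * b + b) / a) ^ 2) * Real.exp (6 * b * T))) ≤ 1 / 4

namespace Regime

variable {a b D T M K V ρ ε η : ℝ} {G : ℝ → ℝ} {u p : ℝ → ℝ × ℝ}

lemma ρ_pos (h : Regime a b D T M K V ρ ε η G u) : 0 < ρ := h.η_pos.trans_le h.η_le

lemma D_le_M (h : Regime a b D T M K V ρ ε η G u) : D ≤ M := by
  have := h.abs_fst_le T (right_mem_Icc.2 h.T_pos.le)
  rwa [h.T_eq, abs_neg, abs_of_pos h.D_pos] at this

lemma sq_error_le (h : Regime a b D T M K V ρ ε η G u) (hp : IsSol a G p) {Y : ℝ}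
    (hY : Y ∈ Icc 0 η) (hp0 : p 0 = (0, Y)) {t : ℝ} (ht : t ∈ Icc 0 T) :
    ((p t).1 - (u t).1) ^ 2 + ((p t).2 - (u t).2) ^ 2 ≤
      Real.exp (5 * b * T) * (η ^ 2 + ε ^ 2) := by
  have hb := h.b_pos
  have h1 := hp.sq_dist_linear_le hb h.ε_pos h.η_pos.le
    (by linarith [h.D_pos, h.D_le_M, h.lt_K, h.ρ_pos])
    h.cutoff h.isSol ht.1 fun s hs => h.snd_nonpos s ⟨hs.1.le, hs.2.le.trans ht.2⟩
  rw [hp0, h.zero_eq] at h1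
  refine h1.trans (mul_le_mul (Real.exp_le_exp.2 ?_) ?_ (by positivity) (Real.exp_pos _).le)
  · exact mul_le_mul_of_nonneg_left ht.2 (by positivity)
  · have := pow_le_pow_left₀ hY.1 hY.2 2
    simp only [sub_zero]
    linarith

lemma tracking (h : Regime a b D T M K V ρ ε η G u) (hp : IsSol a G p) {Y : ℝ}
    (hY : Y ∈ Icc 0 η) (hp0 : p 0 = (0, Y)) {t : ℝ} (ht : t ∈ Icc 0 T) :
    |(p t).1 - (u t).1| ≤ ρ ∧ |(p t).2 - (u t).2| ≤ ρ := by
  have h1 := (h.sq_error_le hp hY hp0 ht).trans h.error_le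
  constructor <;> refine abs_le_of_sq_le_sq ?_ h.ρ_pos.le <;>
    nlinarith [sq_nonneg ((p t).1 - (u t).1), sq_nonneg ((p t).2 - (u t).2)]

lemma tracking_sliding (h : Regime a b D T M K V ρ ε η G u) (hp : IsSol a G p) {Y : ℝ}
    (hY : Y ∈ Icc 0 η) (hp0 : p 0 = (0, Y)) {t : ℝ} (ht : t ∈ Icc T (T + D / a)) :
    |(p t).1 - (-D + a * (t - T))| ≤ ρ ∧ |(p t).2| ≤ ρ := by
  have ha := h.a_pos
  have hb := h.b_pos
  have hD := h.D_pos
  have hε := h.ε_pos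
  have hη := h.η_pos
  have htD : t - T ≤ D / a := by linarith [ht.2]
  have h0 := h.sq_error_le hp hY hp0 (right_mem_Icc.2 h.T_pos.le)
  rw [h.T_eq] at h0
  have h1 := hp.sq_dist_sliding_le hb hε hη.le hD.le
    (by linarith [h.D_pos, h.D_le_M, h.lt_K, h.ρ_pos]) h.cutoff (x₀ := -D) ht.1 fun s hs => by
      have h2 : a * (s - T) ≤ D := by
        rw [mul_comm, ← le_div_iff₀ ha]; linarith [hs.2]
      have h3 := mul_nonneg ha.le (sub_nonneg.2 hs.1.le)
      constructor <;> linarith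
  have h2 : Real.exp (4 * b * (t - T)) *
        (((p T).1 - -D) ^ 2 + (p T).2 ^ 2 + η * (D + b * ε) / (2 * b)) ≤ ρ ^ 2 := by
    refine le_trans (mul_le_mul (Real.exp_le_exp.2 ?_) ?_ (by positivity)
      (Real.exp_pos _).le) h.error_le'
    · exact mul_le_mul_of_nonneg_left htD (by positivity)
    · simp only [sub_zero] at h0; linarith
  have h3 := h1.trans h2
  constructor <;> refine abs_le_of_sq_le_sq ?_ h.ρ_pos.le <;>
    nlinarith [sq_nonneg ((p t).1 - (-D + a * (t - T))), sq_nonneg ((p t).2)]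

end Regime

/-- `τ` is a return time of `p` to the section `x = 0`. -/
structure IsReturn (a T D V ρ ε η : ℝ) (p : ℝ → ℝ × ℝ) (τ : ℝ) : Prop where
  lt : T < τ
  fst_eq : (p τ).1 = 0
  snd_mem : (p τ).2 ∈ Icc 0 η
  snd_le : ∀ t ∈ Icc 0 τ, (p t).2 ≤ η
  fst_mem : ∀ t ∈ Icc T τ, (p t).1 ∈ Icc (-(2 * D)) 0
  le_snd : ∀ t ∈ Icc T τ, -ρ ≤ (p t).2
  le_snd_of_mem : ∀ t ∈ Icc T τ, (p t).1 ∈ Icc (-D / 2) (-D / 4) → ε * V ≤ (p t).2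
  late : ∀ t ∈ Icc (T + D / a) τ, -ρ ≤ (p t).1 ∧ 0 ≤ (p t).2

namespace Regime

variable {a b D T M K V ρ ε η : ℝ} {G : ℝ → ℝ} {u p : ℝ → ℝ × ℝ}

lemma D_lt_K (h : Regime a b D T M K V ρ ε η G u) : D + ρ < K := by
  linarith [h.D_le_M, h.lt_K]

lemma mul_exp_le (h : Regime a b D T M K V ρ ε η G u) {y : ℝ} (hy0 : 0 ≤ y)
    (hy : y ≤ ε * V) : -(D / 8) ≤ damp b ε y := by
  have hb := h.b_pos
  have hε := h.ε_pos
  have h1 : y / ε ≤ V := by rw [div_le_iff₀ hε]; linarith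
  have h2 : y * Real.exp (y / ε) ≤ ε * V * Real.exp V :=
    mul_le_mul hy (Real.exp_le_exp.2 h1) (Real.exp_pos _).le (mul_nonneg hε.le h.V_nonneg)
  have h3 := mul_le_mul_of_nonneg_left h2 hb.le
  have h4 := h.εV_exp_le
  have h5 := mul_nonneg hb.le hy0
  rw [damp]
  nlinarith

lemma εV_le_η (h : Regime a b D T M K V ρ ε η G u) : ε * V ≤ η := by
  by_contra! hcon
  have h1 := h.mul_exp_le h.η_pos.le hcon.le
  have h2 := h.cutoff.le_neg η le_rfl
  rw [h.cutoff.eq_damp η le_rfl] at h2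
  linarith [h.D_lt_K, h.D_pos, h.ρ_pos]

lemma neg_le_cutoff (h : Regime a b D T M K V ρ ε η G u) {y : ℝ} (hyρ : -ρ ≤ y)
    (hy : y ≤ ε * V) : -(D / 8) - 2 * b * ρ ≤ G y := by
  have hb := h.b_pos
  have hbρ := mul_pos hb h.ρ_pos
  rw [h.cutoff.eq_damp y (hy.trans h.εV_le_η)]
  rcases le_total y 0 with h0 | h0
  · have := two_mul_le_damp (ε := ε) hb h0
    nlinarith [h.D_pos]
  · have := h.mul_exp_le h0 hy
    linarith

lemma exists_isReturn (h : Regime a b D T M K V ρ ε η G u) (hp : IsSol a G p) {Y : ℝ}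
    (hY : Y ∈ Icc 0 η) (hp0 : p 0 = (0, Y)) :
    ∃ τ, IsReturn a T D V ρ ε η p τ := by
  have ha := h.a_pos
  have hb := h.b_pos
  have hD := h.D_pos
  have hρ := h.ρ_pos
  have hε := h.ε_pos
  have hρD := h.ρ_le_D
  have hT := h.T_pos
  have hbρ := mul_pos hb hρ
  have hεV : 0 ≤ ε * V := mul_nonneg hε.le h.V_nonneg
  have hlK := h.D_lt_K
  have hℓ : 0 < D / (4 * a) := by positivity
  have haℓ : a * (D / (4 * a)) = D / 4 := by field_simp
  set t₁ := T + D / (4 * a) with ht₁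
  have hℓD : D / (4 * a) ≤ D / a := div_le_div_of_nonneg_left hD.le ha (by linarith)
  have htr : ∀ t ∈ Icc T t₁, (p t).1 ∈ Icc (-D - ρ) (-D / 2 - D / 8) ∧ -ρ ≤ (p t).2 :=
    fun t ht => by
      have h1 := h.tracking_sliding hp hY hp0 (t := t) ⟨ht.1, by linarith [ht.2]⟩
      have h2 := abs_le.1 h1.1
      have h3 := abs_le.1 h1.2
      have h4 := mul_nonneg ha.le (sub_nonneg.2 ht.1)
      have h5 : a * (t - T) ≤ D / 4 := by
        rw [← haℓ]; exact mul_le_mul_of_nonneg_left (by linarith [ht.2]) ha.le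
      refine ⟨⟨?_, ?_⟩, ?_⟩ <;> linarith
  have hTt₁ : T ≤ t₁ := by linarith
  have ht₁m := htr t₁ (right_mem_Icc.2 hTt₁)
  have hxK₁ : ∀ t ∈ Ico 0 t₁, -K < (p t).1 := fun t ht => by
    rcases le_total t T with h' | h'
    · have h1 := (abs_le.1 (h.tracking hp hY hp0 ⟨ht.1, h'⟩).1).1
      have h2 := (abs_le.1 (h.abs_fst_le t ⟨ht.1, h'⟩)).1
      linarith [h.lt_K]
    · linarith [(htr t ⟨h', ht.2.le⟩).1.1]
  have hyη : ∀ t ∈ Icc 0 t₁, (p t).2 ≤ η := fun t ht =>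
    hp.snd_le (h.cutoff.le_neg η le_rfl) ht.1 (by rw [hp0]; exact hY.2)
      fun r hr => hxK₁ r ⟨hr.1, hr.2.trans_le ht.2⟩
  have hyV₁ : ε * V ≤ (p t₁).2 := by
    have hm : 0 < (ρ + ε * V) / (D / (4 * a)) := by positivity
    have hmul : (ρ + ε * V) / (D / (4 * a)) * (D / (4 * a)) = ρ + ε * V :=
      div_mul_cancel₀ _ hℓ.ne'
    have := hp.le_snd_of_linear (c := -ρ) (m := (ρ + ε * V) / (D / (4 * a))) hTt₁
      (htr T (left_mem_Icc.2 hTt₁)).2 fun r hr => by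
        set m := (ρ + ε * V) / (D / (4 * a)) with hm_def
        have h1 := (htr r ⟨hr.1, hr.2.le⟩).1.2
        have h2 : m * (r - T) ≤ ρ + ε * V := by
          rw [← hmul]; exact mul_le_mul_of_nonneg_left (by linarith [hr.2]) hm.le
        have h2' := mul_nonneg hm.le (sub_nonneg.2 hr.1)
        have h3 := h.neg_le_cutoff (y := -ρ + m * (r - T)) (by linarith) (by linarith)
        have h4 : m ≤ 8 * a * ρ / D := by
          have : m = 4 * a * (ρ + ε * V) / D := by rw [hm_def]; field_simp
          rw [this]
          refine div_le_div_of_nonneg_right ?_ hD.le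
          nlinarith [h.εV_le]
        have h5 : 8 * a * ρ / D + 2 * b * ρ < D / 2 := by
          have := h.ρ_lt
          rw [div_add' _ _ _ hD.ne', div_lt_iff₀ hD]
          nlinarith
        linarith
    have h1 : t₁ - T = D / (4 * a) := by rw [ht₁]; ring
    rw [h1, hmul] at this
    linarith
  obtain ⟨τ, hτ, -, hτ0, hτt⟩ := hp.exists_reach ha h.η_pos.le h.cutoff
    (by linarith [ht₁m.1.2]) (by linarith [ht₁m.1.1]) (hεV.trans hyV₁)
    (hyη t₁ ⟨by linarith, le_rfl⟩)
  have hmono : ∀ r t, t₁ ≤ r → r ≤ t → t ≤ τ → a * (t - r) ≤ (p t).1 - (p r).1 :=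
    fun r t hr hrt ht => by
      simpa using hp.mul_sub_le_fst_sub (c := 0) hrt fun s hs =>
        (hτt s ⟨hr.trans hs.1.le, hs.2.le.trans ht⟩).2.2.1
  have hlate : ∀ t ∈ Icc (T + D / a) τ, -ρ ≤ (p t).1 := fun t ht => by
    have h1 := hmono (T + D / a) t (by linarith) ht.1 ht.2
    have h2 := (h.tracking_sliding hp hY hp0 (t := T + D / a)
      ⟨by linarith, le_rfl⟩).1
    have h3 : -D + a * (T + D / a - T) = 0 := by field_simp; ring
    rw [h3, sub_zero] at h2
    have h4 := mul_nonneg ha.le (sub_nonneg.2 ht.1)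
    linarith [(abs_le.1 h2).1]
  refine ⟨τ, by linarith, hτ0, (hτt τ ⟨hτ, le_rfl⟩).2.2, fun t ht => ?_, fun t ht => ?_,
    fun t ht => ?_, fun t ht hx => ?_, fun t ht => ⟨hlate t ht, ?_⟩⟩
  · rcases le_total t t₁ with h' | h'
    · exact hyη t ⟨ht.1, h'⟩
    · exact (hτt t ⟨h', ht.2⟩).2.2.2
  · rcases le_total t t₁ with h' | h'
    · have := (htr t ⟨ht.1, h'⟩).1
      constructor <;> linarith [this.1, this.2]
    · have h1 := hτt t ⟨h', ht.2⟩
      have h2 := mul_nonneg ha.le (sub_nonneg.2 h')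
      exact ⟨by linarith [ht₁m.1.1, h1.2.1], h1.1⟩
  · rcases le_total t t₁ with h' | h'
    · exact (htr t ⟨ht.1, h'⟩).2
    · linarith [(hτt t ⟨h', ht.2⟩).2.2.1]
  · rcases le_total t t₁ with h' | h'
    · linarith [(htr t ⟨ht.1, h'⟩).1.2, hx.1]
    · refine hp.le_snd h' hyV₁ fun r hr => ?_
      have h1 := hmono r t hr.1 hr.2.le ht.2
      have h2 := mul_pos ha (sub_pos.2 hr.2)
      have h3 := h.mul_exp_le hεV le_rfl
      rw [h.cutoff.eq_damp _ h.εV_le_η]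
      linarith [hx.2]
  · exact (hτt t ⟨by linarith [ht.1], ht.2⟩).2.2.1

end Regime

lemma IsSol.exists_graph {a : ℝ} {G : ℝ → ℝ} {p : ℝ → ℝ × ℝ} (ha : 0 < a) (hp : IsSol a G p)
    {T τ : ℝ} (hT : T ≤ τ) (hy : ∀ t ∈ Icc T τ, -(a / 2) ≤ (p t).2) :
    ∃ f : ℝ → ℝ, (∀ t ∈ Icc T τ, f (p t).1 = (p t).2) ∧
      (∀ x ∈ Icc (p T).1 (p τ).1, ∃ t ∈ Icc T τ, (p t).1 = x) ∧
      ContinuousOn f (Icc (p T).1 (p τ).1) ∧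
      ∀ x ∈ Ioo (p T).1 (p τ).1, HasDerivAt f ((-x + G (f x)) / (f x + a)) x := by
  have hgrow : ∀ s ∈ Icc T τ, ∀ t ∈ Icc T τ, s ≤ t → a / 2 * (t - s) ≤ (p t).1 - (p s).1 :=
    fun s hs t ht hst => by
      have := hp.mul_sub_le_fst_sub (c := -(a / 2)) hst fun r hr =>
        hy r ⟨hs.1.trans hr.1.le, hr.2.le.trans ht.2⟩
      have h2 : -(a / 2) + a = a / 2 := by ring
      rwa [h2] at this
  have habs : ∀ s ∈ Icc T τ, ∀ t ∈ Icc T τ, a / 2 * |t - s| ≤ |(p t).1 - (p s).1| := by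
    intro s hs t ht
    rcases le_total s t with h | h
    · rw [abs_of_nonneg (sub_nonneg.2 h)]
      exact (hgrow s hs t ht h).trans (le_abs_self _)
    · rw [abs_sub_comm, abs_of_nonneg (sub_nonneg.2 h), abs_sub_comm]
      exact (hgrow t ht s hs h).trans (le_abs_self _)
  have hxc : Continuous fun t => (p t).1 := continuous_fst.comp hp.continuous
  have hsurj : ∀ x ∈ Icc (p T).1 (p τ).1, ∃ t ∈ Icc T τ, (p t).1 = x := fun x hx =>
    intermediate_value_Icc hT hxc.continuousOn hx
  choose! g hg hgx using hsurj
  have hT' := left_mem_Icc.2 hT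
  have hτ' := right_mem_Icc.2 hT
  have hmem : ∀ t ∈ Icc T τ, (p t).1 ∈ Icc (p T).1 (p τ).1 := fun t ht => by
    have h1 := hgrow T hT' t ht ht.1
    have h2 := hgrow t ht τ hτ' ht.2
    have h3 := mul_nonneg ha.le (sub_nonneg.2 ht.1)
    have h4 := mul_nonneg ha.le (sub_nonneg.2 ht.2)
    constructor <;> linarith
  have hgleft : ∀ t ∈ Icc T τ, g (p t).1 = t := fun t ht => by
    have h1 := habs t ht _ (hg _ (hmem t ht))
    rw [hgx _ (hmem t ht), sub_self, abs_zero] at h1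
    have h2 := abs_nonneg (g (p t).1 - t)
    have h3 : |g (p t).1 - t| = 0 := le_antisymm (by nlinarith) h2
    linarith [abs_eq_zero.1 h3]
  have hgc : ContinuousOn g (Icc (p T).1 (p τ).1) := by
    refine LipschitzOnWith.continuousOn (K := (2 / a).toNNReal)
      (LipschitzOnWith.of_dist_le_mul fun x hx x' hx' => ?_)
    have h1 := habs _ (hg x' hx') _ (hg x hx)
    rw [hgx x hx, hgx x' hx'] at h1
    rw [Real.dist_eq, Real.dist_eq, Real.coe_toNNReal _ (by positivity), div_mul_eq_mul_div,
      le_div_iff₀ ha]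
    linarith
  refine ⟨fun x => (p (g x)).2, fun t ht => by simp only [hgleft t ht],
    fun x hx => ⟨g x, hg x hx, hgx x hx⟩,
    (continuous_snd.comp hp.continuous).comp_continuousOn hgc, fun x hx => ?_⟩
  have hx' := Ioo_subset_Icc_self hx
  have hne : (p (g x)).2 + a ≠ 0 := by linarith [hy _ (hg x hx')]
  have hgd : HasDerivAt g ((p (g x)).2 + a)⁻¹ x :=
    (hp.fst (g x)).of_local_left_inverse (hgc.continuousAt (Icc_mem_nhds hx.1 hx.2)) hne
      (by filter_upwards [Icc_mem_nhds hx.1 hx.2] with z hz using hgx z hz)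
  have := (hp.snd (g x)).comp x hgd
  rw [hgx x hx'] at this
  exact this

/-- Two graphs of solutions of the orbit equation `dy/dx = (-x + damp y) / (y + a)` separate at
a rate bounded independently of `ε`. -/
lemma sq_sub_le_of_graph {a b ε C x₁ x₂ : ℝ} {f g : ℝ → ℝ} (hx : x₁ ≤ x₂)
    (hf : ContinuousOn f (Icc x₁ x₂)) (hg : ContinuousOn g (Icc x₁ x₂))
    (hf' : ∀ x ∈ Ioo x₁ x₂, HasDerivAt f ((-x + damp b ε (f x)) / (f x + a)) x)
    (hg' : ∀ x ∈ Ioo x₁ x₂, HasDerivAt g ((-x + damp b ε (g x)) / (g x + a)) x)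
    (h : ∀ x ∈ Ioo x₁ x₂, ∀ y z, (y = f x ∧ z = g x ∨ y = g x ∧ z = f x) → y ≤ z →
      ((-x + damp b ε z) / (z + a) - (-x + damp b ε y) / (y + a)) ≤ C * (z - y)) :
    (f x₂ - g x₂) ^ 2 ≤ Real.exp (2 * C * (x₂ - x₁)) * (f x₁ - g x₁) ^ 2 := by
  refine le_exp_mul_of_deriv_le (f := fun x => (f x - g x) ^ 2) hx ((hf.sub hg).pow 2)
    (fun x hx => ((hf' x hx).fun_sub (hg' x hx)).fun_pow 2) fun x hx => ?_
  norm_num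
  rcases le_total (f x) (g x) with h' | h'
  · have := h x hx _ _ (Or.inl ⟨rfl, rfl⟩) h'
    nlinarith
  · have := h x hx _ _ (Or.inr ⟨rfl, rfl⟩) h'
    nlinarith

lemma slope_sub_le {a b ε x y z : ℝ} (ha : 0 < a) (hb : 0 < b) (hε : 0 < ε) (hx : x ≤ 0)
    (hy : -(a / 2) ≤ y) (hyz : y ≤ z) :
    (-x + damp b ε z) / (z + a) - (-x + damp b ε y) / (y + a) ≤ 12 * b / a * (z - y) := by
  have h1 := slope_num_le ha hb hε hx hy hyz
  have hy' : a / 2 ≤ y + a := by linarith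
  have hz' : a / 2 ≤ z + a := by linarith
  have hy0 : 0 < y + a := by linarith
  have hz0 : 0 < z + a := by linarith
  have h2 : a / 2 * (a / 2) ≤ (z + a) * (y + a) := mul_le_mul hz' hy' (by positivity) hz0.le
  rw [div_sub_div _ _ hz0.ne' hy0.ne', div_le_iff₀ (by positivity)]
  have h3 : 0 ≤ 12 * b / a * (z - y) := mul_nonneg (by positivity) (sub_nonneg.2 hyz)
  have h4 := mul_le_mul_of_nonneg_left h2 h3
  have h5 : 12 * b / a * (z - y) * (a / 2 * (a / 2)) = 3 * a * b * (z - y) := by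
    field_simp; ring
  linarith

lemma slope_sub_le_of_le {a b ε V x y z : ℝ} (ha : 0 < a) (hb : 0 < b) (hε : 0 < ε)
    (hV : 0 ≤ V) (hV2 : 2 ≤ Real.exp V) (hx : x ≤ 0) (hy : ε * V ≤ y) (hyz : y ≤ z)
    (hz : z ≤ a) :
    (-x + damp b ε z) / (z + a) - (-x + damp b ε y) / (y + a) ≤
      -(b * (Real.exp V - 2) / (4 * a)) * (z - y) := by
  have h1 := slope_num_le_of_le ha hb hε hx hV hy hyz
  have hεV : 0 ≤ ε * V := by positivity
  have hy0 : 0 < y + a := by linarith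
  have hz0 : 0 < z + a := by linarith
  have h2 : (z + a) * (y + a) ≤ 2 * a * (2 * a) :=
    mul_le_mul (by linarith) (by linarith) hy0.le (by positivity)
  rw [div_sub_div _ _ hz0.ne' hy0.ne', div_le_iff₀ (by positivity)]
  have h3 : 0 ≤ b * (Real.exp V - 2) / (4 * a) * (z - y) :=
    mul_nonneg (div_nonneg (mul_nonneg hb.le (by linarith)) (by positivity)) (sub_nonneg.2 hyz)
  have h4 := mul_le_mul_of_nonneg_left h2 h3
  have h5 : b * (Real.exp V - 2) / (4 * a) * (z - y) * (2 * a * (2 * a)) =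
    a * b * (Real.exp V - 2) * (z - y) := by
    field_simp; ring
  linarith

lemma abs_slope_le {a b D ε η K x y : ℝ} (ha : 0 < a) (hb : 0 < b) (hε : 0 < ε) (hε1 : ε ≤ 1)
    (hK : 0 ≤ K) (hD : 0 ≤ D) (hη : damp b ε η = -K) (hx : x ∈ Icc (-(2 * D)) 0)
    (hy : -(a / 2) ≤ y) (hyη : y ≤ η) :
    |(-x + damp b ε y) / (y + a)| ≤ 2 * (2 * D + K + a * b + b) / a := by
  have hy0 : 0 < y + a := by linarith
  have h1 := damp_le hb hε y
  have h2 : b * ε ≤ b := by nlinarith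
  have hab : 0 < a * b := by positivity
  have h3 : -(K + a * b) ≤ damp b ε y := by
    rcases le_total 0 y with h | h
    · have := neg_le_damp hb hε hK hη h hyη
      linarith
    · have := two_mul_le_damp (ε := ε) hb h
      nlinarith
  have h4 : |-x + damp b ε y| ≤ 2 * D + K + a * b + b :=
    abs_le.2 ⟨by linarith [hx.2], by linarith [hx.1]⟩
  rw [abs_div, abs_of_pos hy0, div_le_div_iff₀ hy0 ha]
  have h5 : 0 ≤ 2 * D + K + a * b + b := by positivity
  nlinarith [mul_le_mul_of_nonneg_right h4 ha.le]

namespace Regime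

variable {a b D T M K V ρ ε η : ℝ} {G : ℝ → ℝ} {u p q : ℝ → ℝ × ℝ}

lemma K_pos (h : Regime a b D T M K V ρ ε η G u) : 0 < K := by
  linarith [h.D_lt_K, h.D_pos, h.ρ_pos]

/-- The orbit of `p` between `T` and a return time, as the graph of a function of `x`. -/
lemma exists_graph (h : Regime a b D T M K V ρ ε η G u) (hp : IsSol a G p) {τ : ℝ}
    (hτ : IsReturn a T D V ρ ε η p τ) :
    ∃ f : ℝ → ℝ, f (p T).1 = (p T).2 ∧ f 0 = (p τ).2 ∧ ContinuousOn f (Icc (p T).1 0) ∧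
      (∀ x ∈ Ioo (p T).1 0, HasDerivAt f ((-x + damp b ε (f x)) / (f x + a)) x) ∧
      (∀ x ∈ Icc (p T).1 0, -(a / 2) ≤ f x ∧ f x ≤ η) ∧
      ∀ x ∈ Icc (p T).1 0, x ∈ Icc (-D / 2) (-D / 4) → ε * V ≤ f x := by
  obtain ⟨f, hf, hsurj, hc, hd⟩ := hp.exists_graph h.a_pos hτ.lt.le fun t ht => by
    linarith [hτ.le_snd t ht, h.ρ_le_a]
  rw [hτ.fst_eq] at hsurj hc hd
  have hb : ∀ x ∈ Icc (p T).1 0, -(a / 2) ≤ f x ∧ f x ≤ η := fun x hx => by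
    obtain ⟨t, ht, rfl⟩ := hsurj x hx
    rw [hf t ht]
    exact ⟨by linarith [hτ.le_snd t ht, h.ρ_le_a], hτ.snd_le t ⟨h.T_pos.le.trans ht.1, ht.2⟩⟩
  refine ⟨f, hf T (left_mem_Icc.2 hτ.lt.le), ?_, hc, fun x hx => ?_, hb, fun x hx hx' => ?_⟩
  · rw [← hτ.fst_eq]; exact hf τ (right_mem_Icc.2 hτ.lt.le)
  · rw [← h.cutoff.eq_damp _ (hb x (Ioo_subset_Icc_self hx)).2]
    exact hd x hx
  · obtain ⟨t, ht, rfl⟩ := hsurj x hx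
    rw [hf t ht]
    exact hτ.le_snd_of_mem t ht hx'

lemma sq_return_sub_le (h : Regime a b D T M K V ρ ε η G u) (hp : IsSol a G p)
    (hq : IsSol a G q) {Y Z τ σ : ℝ} (hY : Y ∈ Icc 0 η) (hZ : Z ∈ Icc 0 η) (hp0 : p 0 = (0, Y))
    (hq0 : q 0 = (0, Z)) (hτ : IsReturn a T D V ρ ε η p τ) (hσ : IsReturn a T D V ρ ε η q σ) :
    ((p τ).2 - (q σ).2) ^ 2 ≤ 1 / 4 * (Y - Z) ^ 2 := by
  wlog hpq : (p T).1 ≤ (q T).1 generalizing p q Y Z τ σ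
  · rw [sub_sq_comm, sub_sq_comm Y]
    exact this hq hp hZ hY hq0 hp0 hσ hτ (le_of_not_ge hpq)
  have ha := h.a_pos
  have hb := h.b_pos
  have hε := h.ε_pos
  have hD := h.D_pos
  have hTT := right_mem_Icc.2 h.T_pos.le
  set C := 2 * (2 * D + K + a * b + b) / a with hC
  set x₁ := (p T).1 with hx₁
  set x₂ := (q T).1 with hx₂
  have hx₁D : -(2 * D) ≤ x₁ := (hτ.fst_mem T (left_mem_Icc.2 hτ.lt.le)).1
  have hx₂D : x₂ ≤ -D / 2 := by
    have h1 := (abs_le.1 (h.tracking hq hZ hq0 hTT).1).2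
    rw [h.T_eq] at h1
    simp only at h1
    linarith [h.ρ_le_D]
  obtain ⟨f, hfT, hf0, hfc, hfd, hfb, hfV⟩ := h.exists_graph hp hτ
  obtain ⟨g, hgT, hg0, hgc, hgd, hgb, hgV⟩ := h.exists_graph hq hσ
  have hηa : η ≤ a := by linarith [h.η_le, h.ρ_le_a]
  -- the two graphs at the later starting abscissa
  have hstart : (f x₂ - g x₂) ^ 2 ≤
      2 * (1 + C ^ 2) * (Real.exp (6 * b * T) * (Y - Z) ^ 2) := by
    have h1 := IsSol.sq_dist_le hb h.cutoff hp hq h.T_pos.le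
    rw [hp0, hq0] at h1
    simp only [sub_self, ne_eq, OfNat.ofNat_ne_zero, not_false_eq_true, zero_pow, zero_add] at h1
    refine le_trans ?_ (mul_le_mul_of_nonneg_left h1 (by positivity))
    have h2 : |f x₂ - f x₁| ≤ C * (x₂ - x₁) := by
      rcases hpq.eq_or_lt with heq | hlt
      · rw [heq]; simp
      · obtain ⟨c, hc, hslope⟩ := exists_hasDerivAt_eq_slope f _ hlt
          (hfc.mono (Icc_subset_Icc le_rfl (by linarith)))
          fun x hx => hfd x ⟨hx.1, by linarith [hx.2]⟩
        have hc' : c ∈ Icc x₁ 0 := ⟨hc.1.le, by linarith [hc.2]⟩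
        have h3 := abs_slope_le ha hb hε h.ε_le h.K_pos.le hD.le h.damp_eq
          ⟨hx₁D.trans hc'.1, hc'.2⟩ (hfb c hc').1 (hfb c hc').2
        rw [hslope, abs_div, abs_of_pos (sub_pos.2 hlt), div_le_iff₀ (sub_pos.2 hlt)] at h3
        exact h3
    have h3 : (f x₂ - f x₁) ^ 2 ≤ C ^ 2 * (x₁ - x₂) ^ 2 := by
      have := pow_le_pow_left₀ (abs_nonneg _) h2 2
      rw [sq_abs] at this
      nlinarith
    rw [← hfT, ← hgT]
    nlinarith [sq_nonneg ((f x₂ - f x₁) - (f x₁ - g x₂)), sq_nonneg (x₁ - x₂),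
      mul_nonneg (sq_nonneg C) (sq_nonneg (f x₁ - g x₂))]
  have hsub : ∀ {α β : ℝ}, x₂ ≤ α → β ≤ 0 → Icc α β ⊆ Icc x₁ 0 ∧ Icc α β ⊆ Icc x₂ 0 :=
    fun h1 h2 => ⟨Icc_subset_Icc (hpq.trans h1) h2, Icc_subset_Icc h1 h2⟩
  have hgen : ∀ {α β : ℝ}, x₂ ≤ α → α ≤ β → β ≤ 0 →
      (f β - g β) ^ 2 ≤ Real.exp (2 * (12 * b / a) * (β - α)) * (f α - g α) ^ 2 := by
    intro α β h1 h2 h3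
    obtain ⟨s1, s2⟩ := hsub h1 h3
    refine sq_sub_le_of_graph h2 (hfc.mono s1) (hgc.mono s2)
      (fun x hx => hfd x ⟨by linarith [hx.1], by linarith [hx.2]⟩)
      (fun x hx => hgd x ⟨by linarith [hx.1], by linarith [hx.2]⟩) fun x hx y z hyz hle => ?_
    have hx' := Ioo_subset_Icc_self hx
    refine slope_sub_le ha hb hε (hx'.2.trans h3) ?_ hle
    rcases hyz with ⟨rfl, -⟩ | ⟨rfl, -⟩
    exacts [(hfb x (s1 hx')).1, (hgb x (s2 hx')).1]
  have hstrong : (f (-D / 4) - g (-D / 4)) ^ 2 ≤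
      Real.exp (2 * (-(b * (Real.exp V - 2) / (4 * a))) * (-D / 4 - -D / 2)) *
        (f (-D / 2) - g (-D / 2)) ^ 2 := by
    obtain ⟨s1, s2⟩ := hsub (α := -D / 2) (β := -D / 4) hx₂D (by linarith)
    refine sq_sub_le_of_graph (by linarith) (hfc.mono s1) (hgc.mono s2)
      (fun x hx => hfd x ⟨by linarith [hx.1], by linarith [hx.2]⟩)
      (fun x hx => hgd x ⟨by linarith [hx.1], by linarith [hx.2]⟩) fun x hx y z hyz hle => ?_
    have hx' := Ioo_subset_Icc_self hx
    refine slope_sub_le_of_le ha hb hε h.V_nonneg h.two_le_exp (by linarith [hx.2]) ?_ hle ?_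
    · rcases hyz with ⟨rfl, -⟩ | ⟨rfl, -⟩
      exacts [hfV x (s1 hx') hx', hgV x (s2 hx') hx']
    · rcases hyz with ⟨-, rfl⟩ | ⟨-, rfl⟩
      exacts [(hgb x (s2 hx')).2.trans hηa, (hfb x (s1 hx')).2.trans hηa]
  have h1 := hgen le_rfl hx₂D (by linarith)
  have h3 := hgen (α := -D / 4) (β := 0) (by linarith) (by linarith) le_rfl
  rw [hf0, hg0] at h3
  have e : 2 * (-(b * (Real.exp V - 2) / (4 * a))) * (-D / 4 - -D / 2) =
      -(b * (Real.exp V - 2) * D / (8 * a)) := by field_simp; ring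
  rw [e] at hstrong
  have hexp : Real.exp (2 * (12 * b / a) * (0 - -D / 4)) *
      Real.exp (2 * (12 * b / a) * (-D / 2 - x₂)) ≤ Real.exp (48 * b * D / a) := by
    rw [← Real.exp_add, Real.exp_le_exp]
    have h0 : 0 ≤ 12 * b / a := by positivity
    have : 48 * b * D / a = 2 * (12 * b / a) * (2 * D) := by ring
    rw [this]
    nlinarith
  set E := Real.exp (-(b * (Real.exp V - 2) * D / (8 * a)))
  set E₁ := Real.exp (2 * (12 * b / a) * (0 - -D / 4))
  set E₂ := Real.exp (2 * (12 * b / a) * (-D / 2 - x₂))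
  have hE : 0 < E := Real.exp_pos _
  have hE₁ : 0 < E₁ := Real.exp_pos _
  have hE₂ : 0 < E₂ := Real.exp_pos _
  calc ((p τ).2 - (q σ).2) ^ 2 ≤ E₁ * (E * (E₂ * (f x₂ - g x₂) ^ 2)) := by
        refine h3.trans (mul_le_mul_of_nonneg_left ?_ hE₁.le)
        exact hstrong.trans (mul_le_mul_of_nonneg_left h1 hE.le)
    _ = E * (E₁ * E₂ * (f x₂ - g x₂) ^ 2) := by ring
    _ ≤ E * (Real.exp (48 * b * D / a) *
          (2 * (1 + C ^ 2) * (Real.exp (6 * b * T) * (Y - Z) ^ 2))) :=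
        mul_le_mul_of_nonneg_left (mul_le_mul hexp hstart (sq_nonneg _) (Real.exp_pos _).le) hE.le
    _ = E * (Real.exp (48 * b * D / a) *
          (2 * (1 + C ^ 2) * Real.exp (6 * b * T))) * (Y - Z) ^ 2 := by ring
    _ ≤ 1 / 4 * (Y - Z) ^ 2 := mul_le_mul_of_nonneg_right h.contract (sq_nonneg _)

end Regime

lemma nonneg_of_hasDerivAt_of_right {f : ℝ → ℝ} {f' s t : ℝ} (hst : s < t)
    (hf : HasDerivAt f f' s) (hs : f s = 0) (h : ∀ r ∈ Ioc s t, 0 ≤ f r) : 0 ≤ f' := by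
  have h1 := (hasDerivWithinAt_iff_tendsto_slope' (s := Ioi s) (by simp)).1
    hf.hasDerivWithinAt
  refine ge_of_tendsto h1 ?_
  filter_upwards [Ioc_mem_nhdsGT hst] with r hr
  rw [slope_def_field, hs, sub_zero]
  exact div_nonneg (h r hr) (sub_nonneg.2 hr.1.le)

lemma _root_.Monotone.eq_of_periodic {f : ℝ → ℝ} {c : ℝ} (hf : Monotone f) (hc : 0 < c)
    (hp : Function.Periodic f c) (s t : ℝ) : f s = f t := by
  have key : ∀ s t, f s ≤ f t := fun s t => by
    obtain ⟨r, hr, hrs⟩ := hp.exists_mem_Ico hc s (t - c)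
    rw [hrs]
    exact hf (by linarith [hr.2])
  exact le_antisymm (key s t) (key t s)

namespace Regime

variable {a b D T M K V ρ ε η : ℝ} {G : ℝ → ℝ} {u p q : ℝ → ℝ × ℝ}

/-- A closed orbit through the section, lying in every closed invariant set of heights. -/
lemma exists_closed_orbit (h : Regime a b D T M K V ρ ε η G u) :
    ∃ p τ Y, IsSol a G p ∧ Y ∈ Icc 0 η ∧ p 0 = (0, Y) ∧ p τ = p 0 ∧ IsReturn a T D V ρ ε η p τ ∧
      ∀ S : Set ℝ, S ⊆ Icc 0 η → IsClosed S → S.Nonempty →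
        (∀ q Z σ, Z ∈ S → IsSol a G q → q 0 = (0, Z) → IsReturn a T D V ρ ε η q σ →
          (q σ).2 ∈ S) → Y ∈ S := by
  have hsol : ∀ Y : Icc (0 : ℝ) η, ∃ pτ : (ℝ → ℝ × ℝ) × ℝ, IsSol a G pτ.1 ∧
      pτ.1 0 = (0, (Y : ℝ)) ∧ IsReturn a T D V ρ ε η pτ.1 pτ.2 := fun Y => by
    obtain ⟨p, hp0, hp⟩ := exists_isSol a h.cutoff (0, (Y : ℝ))
    obtain ⟨τ, hτ⟩ := h.exists_isReturn hp Y.2 hp0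
    exact ⟨(p, τ), hp, hp0, hτ⟩
  choose φ hφ hφ0 hφτ using hsol
  let P : Icc (0 : ℝ) η → Icc (0 : ℝ) η := fun Y => ⟨((φ Y).1 (φ Y).2).2, (hφτ Y).snd_mem⟩
  have hP : ContractingWith (1 / 2) P := by
    refine ⟨by rw [← NNReal.coe_lt_coe]; norm_num, LipschitzWith.of_dist_le_mul fun Y Z => ?_⟩
    have h1 := h.sq_return_sub_le (hφ Y) (hφ Z) Y.2 Z.2 (hφ0 Y) (hφ0 Z) (hφτ Y) (hφτ Z)
    rw [Subtype.dist_eq, Subtype.dist_eq, Real.dist_eq, Real.dist_eq]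
    have h2 : |((φ Y).1 (φ Y).2).2 - ((φ Z).1 (φ Z).2).2| ≤ |1 / 2 * ((Y : ℝ) - Z)| :=
      sq_le_sq.1 (h1.trans_eq (by ring))
    rw [abs_mul] at h2
    norm_num at h2 ⊢
    exact h2
  have hne : Nonempty (Icc (0 : ℝ) η) := ⟨⟨0, le_rfl, h.η_pos.le⟩⟩
  have : CompleteSpace (Icc (0 : ℝ) η) := isClosed_Icc.completeSpace_coe
  set Y := hP.fixedPoint P
  have hY : P Y = Y := hP.fixedPoint_isFixedPt
  refine ⟨(φ Y).1, (φ Y).2, Y, hφ Y, Y.2, hφ0 Y, ?_, hφτ Y, ?_⟩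
  · rw [hφ0]
    exact Prod.ext (hφτ Y).fst_eq (congrArg Subtype.val hY)
  · rintro S hS hSc ⟨Z, hZ⟩ hinv
    have hit : ∀ n, (P^[n] ⟨Z, hS hZ⟩ : ℝ) ∈ S := fun n => by
      induction n with
      | zero => exact hZ
      | succ n ih =>
        rw [Function.iterate_succ_apply']
        exact hinv _ _ _ ih (hφ _) (hφ0 _) (hφτ _)
    exact hSc.mem_of_tendsto ((continuous_subtype_val.tendsto _).comp
      (hP.tendsto_iterate_fixedPoint ⟨Z, hS hZ⟩)) (Eventually.of_forall hit)

lemma abs_le (h : Regime a b D T M K V ρ ε η G u) (hp : IsSol a G p) {Y τ : ℝ}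
    (hY : Y ∈ Icc 0 η) (hp0 : p 0 = (0, Y)) (hτ : IsReturn a T D V ρ ε η p τ) {t : ℝ}
    (ht : t ∈ Icc 0 τ) : |(p t).1| ≤ 2 * M ∧ |(p t).2| ≤ 2 * M := by
  have hDM := h.D_le_M
  have hρD := h.ρ_le_D
  have hD := h.D_pos
  have hη := h.η_le
  have hρ := h.ρ_pos
  rcases le_total t T with h' | h'
  · have h1 := h.tracking hp hY hp0 ⟨ht.1, h'⟩
    have h2 := abs_sub_abs_le_abs_sub (p t).1 (u t).1
    have h3 := abs_sub_abs_le_abs_sub (p t).2 (u t).2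
    have h4 := h.abs_fst_le t ⟨ht.1, h'⟩
    have h5 := h.abs_snd_le t ⟨ht.1, h'⟩
    constructor <;> linarith
  · have h1 := hτ.fst_mem t ⟨h', ht.2⟩
    have h2 := hτ.le_snd t ⟨h', ht.2⟩
    have h3 := hτ.snd_le t ht
    exact ⟨_root_.abs_le.2 ⟨by linarith [h1.1], by linarith [h1.2]⟩,
      _root_.abs_le.2 ⟨by linarith, by linarith⟩⟩

lemma isPeriodicSol (h : Regime a b D T M K V ρ ε η G u) (hp : IsSol a G p) {Y τ : ℝ}
    (hY : Y ∈ Icc 0 η) (hp0 : p 0 = (0, Y)) (hτ : IsReturn a T D V ρ ε η p τ)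
    (hτ0 : p τ = p 0) :
    Function.Periodic p τ ∧ IsPeriodicSol (corbeillerField a b ε) p := by
  have hT := h.T_pos
  have hτpos : 0 < τ := hT.trans hτ.lt
  obtain ⟨L, hL⟩ := h.cutoff.lipschitz
  have hper : Function.Periodic p τ := fun t =>
    congrFun (IsSol.eq hL (hp.comp_add τ) hp (t₀ := 0) (by simpa using hτ0)) t
  refine ⟨hper, fun t => ?_, ⟨τ, hτpos, hper⟩, ⟨0, T, fun hcon => ?_⟩⟩
  · obtain ⟨s, hs, hst⟩ := hper.exists_mem_Ico₀ hτpos t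
    have h1 := hτ.snd_le s ⟨hs.1, hs.2.le⟩
    rw [← hst] at h1
    have h2 := hp t
    rw [h.cutoff.eq_damp _ h1] at h2
    exact h2
  · have h1 := (_root_.abs_le.1 (h.tracking hp hY hp0 (right_mem_Icc.2 hT.le)).1).2
    rw [← hcon, hp0, h.T_eq] at h1
    simp only at h1
    linarith [h.ρ_le_D, h.D_pos]

/-- A periodic solution in a box of size less than `K` meets the section at height in `[0, η]`. -/
lemma exists_mem_section (h : Regime a b D T M K V ρ ε η G u)
    (hq : IsPeriodicSol (corbeillerField a b ε) q) (hqK : ∀ t, -K < (q t).1) :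
    IsSol a G q ∧ ∃ t, (q t).1 = 0 ∧ (q t).2 ∈ Icc 0 η := by
  obtain ⟨hd, ⟨c, hc, hper⟩, t₁, t₂, hne⟩ := hq
  have ha := h.a_pos
  have hb := h.b_pos
  have hη := h.η_pos
  have hqd : IsSol a (damp b ε) q := hd
  obtain ⟨s₀, hs₀⟩ : ∃ t, (q t).2 ≤ 0 := by
    by_contra! hcon
    have h1 := hqd.mul_sub_le_fst_sub (c := 0) hc.le fun r _ => (hcon r).le
    have h2 := hper 0
    rw [zero_add] at h2
    rw [h2] at h1
    nlinarith
  have hqη : ∀ t, (q t).2 ≤ η := fun t => by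
    obtain ⟨s, hs, hst⟩ := Function.Periodic.exists_mem_Ico (f := q) hper hc t s₀
    rw [hst]
    exact hqd.snd_le h.damp_eq.le hs.1 (hs₀.trans hη.le) fun r _ => hqK r
  have hq : IsSol a G q := fun t => by
    rw [h.cutoff.eq_damp _ (hqη t)]
    exact hqd t
  refine ⟨hq, ?_⟩
  obtain ⟨t₀, ht₀⟩ : ∃ t, 0 < (q t).2 := by
    by_contra! hcon
    set g := damp b ε (-a)
    have hE : ∀ t, HasDerivAt (fun t => ((q t).1 - g) ^ 2 + ((q t).2 + a) ^ 2) _ t := fun t =>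
      (((hqd.fst t).sub_const g).fun_pow 2).fun_add (((hqd.snd t).add_const a).fun_pow 2)
    have hle : ∀ t, b * ((q t).2 + a) ^ 2 ≤ ((q t).2 + a) * (damp b ε (q t).2 - g) := fun t => by
      rcases le_total (q t).2 (-a) with h' | h'
      · have := le_damp_sub hb h.ε_pos h' (by linarith)
        nlinarith
      · have := le_damp_sub hb h.ε_pos h' (hcon t)
        nlinarith
    have hmono : Monotone fun t => ((q t).1 - g) ^ 2 + ((q t).2 + a) ^ 2 :=
      monotone_of_hasDerivAt_nonneg hE fun t => by
        have h1 := hle t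
        have h2 := mul_nonneg hb.le (sq_nonneg ((q t).2 + a))
        norm_num
        linarith
    have hconst := hmono.eq_of_periodic hc (fun t => by simp only [hper t])
    have hy : ∀ t, (q t).2 + a = 0 := fun t => by
      have h1 : HasDerivAt (fun t => ((q t).1 - g) ^ 2 + ((q t).2 + a) ^ 2) 0 t := by
        rw [funext fun t => hconst t 0]
        exact hasDerivAt_const _ _
      have h2 := (hE t).unique h1
      norm_num at h2
      have h3 := hle t
      have h4 : b * ((q t).2 + a) ^ 2 = 0 :=
        le_antisymm (by linarith) (mul_nonneg hb.le (sq_nonneg _))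
      exact pow_eq_zero_iff two_ne_zero |>.1 ((mul_eq_zero.1 h4).resolve_left hb.ne')
    refine hne (Prod.ext ?_ (by linarith [hy t₁, hy t₂]))
    refine is_const_of_deriv_eq_zero (f := fun t => (q t).1)
      (fun t => (hqd.fst t).differentiableAt) (fun t => ?_) t₁ t₂
    rw [(hqd.fst t).deriv, hy t]
  obtain ⟨s₁, hs₁, hs₁0⟩ := Function.Periodic.exists_mem_Ico (f := q) hper hc s₀ (t₀ - c)
  rw [hs₁0] at hs₀
  obtain ⟨σ, hσ, hσ0, hlt⟩ := exists_first_zero (f := fun r => -(q (-r)).2) (s := -t₀)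
    (t := -s₁) (continuous_snd.comp (hq.continuous.comp continuous_neg)).neg
    (by linarith [hs₁.2]) (by simpa using ht₀.le) (by simpa using hs₀)
  have hy0 : (q (-σ)).2 = 0 := by linarith
  have hpos : ∀ r ∈ Ioc (-σ) t₀, 0 ≤ (q r).2 := fun r hr => by
    have := hlt (-r) ⟨by linarith [hr.2], by linarith [hr.1]⟩
    rw [neg_neg] at this
    linarith
  have hσt : -σ < t₀ := by
    refine lt_of_le_of_ne (by linarith [hσ.1]) fun hcon => ?_
    rw [hcon] at hy0
    linarith
  have hG0 : G 0 = 0 := by rw [h.cutoff.eq_damp 0 hη.le, damp_zero]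
  have hx := nonneg_of_hasDerivAt_of_right hσt (hq.snd (-σ)) hy0 hpos
  rw [hy0, hG0] at hx
  obtain ⟨τ, hτ, -, hτ0, hτt⟩ := hq.exists_reach ha hη.le h.cutoff (s := -σ) (by linarith)
    (hqK _) hy0.ge (hy0.trans_le hη.le)
  exact ⟨τ, hτ0, (hτt τ ⟨hτ, le_rfl⟩).2.2⟩

end Regime

lemma dist_le_of_abs_le {z w : ℝ × ℝ} {ρ : ℝ} (h : |z.1 - w.1| ≤ ρ ∧ |z.2 - w.2| ≤ ρ) :
    dist z w ≤ ρ := by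
  rw [Prod.dist_eq, Real.dist_eq, Real.dist_eq]
  exact max_le h.1 h.2

namespace Regime

variable {a b D T M K V ρ ε η : ℝ} {G : ℝ → ℝ} {u p q : ℝ → ℝ × ℝ}

lemma hausdorffDist_le (h : Regime a b D T M K V ρ ε η G u) (hp : IsSol a G p) {Y τ : ℝ}
    (hY : Y ∈ Icc 0 η) (hp0 : p 0 = (0, Y)) (hτ : IsReturn a T D V ρ ε η p τ)
    (hper : Function.Periodic p τ) :
    Metric.hausdorffDist (range p) ((u '' Icc 0 T) ∪ (Icc ((u T).1) 0 ×ˢ ({0} : Set ℝ))) ≤ ρ := by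
  have ha := h.a_pos
  have hD := h.D_pos
  have hτpos : 0 < τ := h.T_pos.trans hτ.lt
  have hT1 : (u T).1 = -D := by rw [h.T_eq]
  rw [hT1]
  refine Metric.hausdorffDist_le_of_mem_dist h.ρ_pos.le ?_ ?_
  · rintro _ ⟨t', rfl⟩
    obtain ⟨t, ht, hpt⟩ := hper.exists_mem_Ico₀ hτpos t'
    rw [hpt]
    rcases le_total t T with h1 | h1
    · exact ⟨u t, Or.inl ⟨t, ⟨ht.1, h1⟩, rfl⟩,
        dist_le_of_abs_le (h.tracking hp hY hp0 ⟨ht.1, h1⟩)⟩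
    rcases le_total t (T + D / a) with h2 | h2
    · refine ⟨(-D + a * (t - T), 0), Or.inr ⟨⟨?_, ?_⟩, rfl⟩, dist_le_of_abs_le ?_⟩
      · have := mul_nonneg ha.le (sub_nonneg.2 h1)
        simp only
        linarith
      · have h3 : t - T ≤ D / a := by linarith
        rw [le_div_iff₀ ha] at h3
        simp only
        linarith
      · simpa using h.tracking_sliding hp hY hp0 ⟨h1, h2⟩
    · refine ⟨(0, 0), Or.inr ⟨⟨by simpa using hD.le, le_rfl⟩, rfl⟩, dist_le_of_abs_le ?_⟩
      have h3 := hτ.late t ⟨h2, ht.2.le⟩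
      have h4 := (hτ.fst_mem t ⟨h1, ht.2.le⟩).2
      have h5 := hτ.snd_le t ⟨ht.1, ht.2.le⟩
      have h6 := h.η_le
      have h7 := h.ρ_pos
      simp only [sub_zero]
      exact ⟨_root_.abs_le.2 ⟨by linarith, by linarith⟩,
        _root_.abs_le.2 ⟨by linarith, by linarith⟩⟩
  · rintro z (⟨t, ht, rfl⟩ | ⟨hz1, hz2⟩)
    · refine ⟨p t, mem_range_self t, ?_⟩
      rw [dist_comm]
      exact dist_le_of_abs_le (h.tracking hp hY hp0 ht)
    · have ht : T + (z.1 + D) / a ∈ Icc T (T + D / a) := by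
        constructor
        · have := div_nonneg (by linarith [hz1.1] : 0 ≤ z.1 + D) ha.le
          linarith
        · have := div_le_div_of_nonneg_right (by linarith [hz1.2] : z.1 + D ≤ D) ha.le
          linarith
      have h1 := h.tracking_sliding hp hY hp0 ht
      refine ⟨p _, mem_range_self (T + (z.1 + D) / a), ?_⟩
      rw [dist_comm]
      have h2 : -D + a * (T + (z.1 + D) / a - T) = z.1 := by field_simp; ring
      have h3 : z.2 = 0 := hz2
      rw [h2] at h1
      refine dist_le_of_abs_le ⟨h1.1, ?_⟩
      rw [h3, sub_zero]
      exact h1.2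

lemma exists_cycle (h : Regime a b D T M K V ρ ε η G u) :
    ∃ p, IsPeriodicSol (corbeillerField a b ε) p ∧
      range p ⊆ Metric.closedBall (0 : ℝ × ℝ) (2 * M) ∧
      (∀ q, IsPeriodicSol (corbeillerField a b ε) q → (∀ t, -K < (q t).1) →
        range q = range p) ∧
      Metric.hausdorffDist (range p)
        ((u '' Icc 0 T) ∪ (Icc ((u T).1) 0 ×ˢ ({0} : Set ℝ))) ≤ ρ := by
  obtain ⟨p, τ, Y, hp, hY, hp0, hpτ, hτ, hS⟩ := h.exists_closed_orbit
  obtain ⟨hper, hpp⟩ := h.isPeriodicSol hp hY hp0 hτ hpτ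
  refine ⟨p, hpp, ?_, fun q hq hqK => ?_, h.hausdorffDist_le hp hY hp0 hτ hper⟩
  · rintro _ ⟨t', rfl⟩
    obtain ⟨t, ht, hpt⟩ := hper.exists_mem_Ico₀ (h.T_pos.trans hτ.lt) t'
    rw [hpt, Metric.mem_closedBall]
    exact dist_le_of_abs_le (by simpa using h.abs_le hp hY hp0 hτ ⟨ht.1, ht.2.le⟩)
  · obtain ⟨L, hL⟩ := h.cutoff.lipschitz
    obtain ⟨hqs, s, hs1, hs2⟩ := h.exists_mem_section hq hqK
    obtain ⟨-, ⟨c, hc, hcper⟩, -⟩ := hq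
    have hcomp : IsClosed (range q) := by
      rw [← Function.Periodic.image_Icc (f := q) hcper hc 0]
      exact (isCompact_Icc.image hqs.continuous).isClosed
    have hYS := hS (Icc 0 η ∩ {Z | ((0 : ℝ), Z) ∈ range q}) inter_subset_left
      (isClosed_Icc.inter (hcomp.preimage (by fun_prop)))
      ⟨(q s).2, hs2, s, Prod.ext hs1 rfl⟩ (by
        rintro q' Z σ ⟨hZ, t, ht⟩ hq' hq'0 hσ
        have heq : q' = fun r => q (r + t) :=
          IsSol.eq hL hq' (hqs.comp_add t) (t₀ := 0) (by simp [hq'0, ht])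
        refine ⟨hσ.snd_mem, σ + t, ?_⟩
        have h1 := hσ.fst_eq
        rw [heq] at h1 ⊢
        exact Prod.ext h1 rfl)
    obtain ⟨-, t, ht⟩ := hYS
    have heq : p = fun r => q (r + t) :=
      IsSol.eq hL hp (hqs.comp_add t) (t₀ := 0) (by simp [hp0, ht])
    rw [heq]
    exact ((Equiv.addRight t).surjective.range_comp q).symm

end Regime

lemma eventually_nhdsGT_lt_of_zero {f : ℝ → ℝ} (hf : Continuous f) (h0 : f 0 = 0) {c : ℝ}
    (hc : 0 < c) : ∀ᶠ x in 𝓝[>] (0 : ℝ), f x < c :=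
  ((hf.tendsto' 0 0 h0).eventually_lt_const hc).filter_mono nhdsWithin_le_nhds

lemma eventually_nhdsGT_pos : ∀ᶠ x in 𝓝[>] (0 : ℝ), 0 < x := self_mem_nhdsWithin

lemma exists_contract_constant {b D a A : ℝ} (ha : 0 < a) (hb : 0 < b) (hD : 0 < D) :
    ∃ V, 0 ≤ V ∧ 2 ≤ Real.exp V ∧
      Real.exp (-(b * (Real.exp V - 2) * D / (8 * a))) * A ≤ 1 / 4 := by
  have h1 : Tendsto (fun V => b * (Real.exp V - 2) * D / (8 * a)) atTop atTop :=
    (((tendsto_atTop_add_const_right _ (-2) Real.tendsto_exp_atTop).const_mul_atTop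
      hb).atTop_mul_const hD).atTop_div_const (by positivity)
  have h2 := (Real.tendsto_exp_neg_atTop_nhds_zero.comp h1).mul_const A
  rw [zero_mul] at h2
  obtain ⟨V, h3, h4, h5⟩ := ((h2.eventually_le_const (by norm_num : (0 : ℝ) < 1 / 4)).and
    ((Real.tendsto_exp_atTop.eventually_ge_atTop 2).and (eventually_ge_atTop 0))).exists
  exact ⟨V, h5, h4, h3⟩

lemma exists_regime {a b D T M K δ : ℝ} {u : ℝ → ℝ × ℝ} (ha : 0 < a) (hb : 0 < b) (hD : 0 < D)
    (hT : 0 < T) (hu : IsSol a (fun y => 2 * b * y) u) (hu0 : u 0 = (0, 0))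
    (huT : u T = (-D, 0)) (hu2 : ∀ t ∈ Icc 0 T, (u t).2 ≤ 0)
    (hM1 : ∀ t ∈ Icc 0 T, |(u t).1| ≤ M) (hM2 : ∀ t ∈ Icc 0 T, |(u t).2| ≤ M)
    (hMK : 2 * M < K) (hδ : 0 < δ) :
    ∀ᶠ ε in 𝓝[>] (0 : ℝ), ∃ V ρ η G, ρ ≤ δ ∧ Regime a b D T M K V ρ ε η G u := by
  have hDM : D ≤ M := by
    have := hM1 T (right_mem_Icc.2 hT.le)
    rwa [huT, abs_neg, abs_of_pos hD] at this
  have hK : 0 < K := by linarith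
  obtain ⟨V, hV, hV2, hVc⟩ := exists_contract_constant (A := Real.exp (48 * b * D / a) *
    (2 * (1 + (2 * (2 * D + K + a * b + b) / a) ^ 2) * Real.exp (6 * b * T))) ha hb hD
  obtain ⟨ρ, hρ, hρδ, hρa, hρD, hρl⟩ : ∃ ρ > 0, ρ < δ ∧ ρ < a / 2 ∧ ρ < D / 8 ∧
      8 * a * ρ + 2 * b * ρ * D < D ^ 2 / 2 :=
    (eventually_nhdsGT_pos.and
      ((eventually_nhdsGT_lt_of_zero continuous_id rfl hδ).and
      ((eventually_nhdsGT_lt_of_zero continuous_id rfl (half_pos ha)).and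
      ((eventually_nhdsGT_lt_of_zero continuous_id rfl (by positivity : 0 < D / 8)).and
      (eventually_nhdsGT_lt_of_zero (f := fun ρ => 8 * a * ρ + 2 * b * ρ * D) (by fun_prop)
        (by simp) (by positivity : 0 < D ^ 2 / 2)))))).exists
  have hρ2 : 0 < ρ ^ 2 := by positivity
  obtain ⟨h, hh, hhρ, herr, herr'⟩ : ∃ h > 0, h < ρ ∧
      Real.exp (5 * b * T) * (h ^ 2 + h ^ 2) < ρ ^ 2 ∧
      Real.exp (4 * b * (D / a)) * (Real.exp (5 * b * T) * (h ^ 2 + h ^ 2) +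
        h * (D + b * h) / (2 * b)) < ρ ^ 2 :=
    (eventually_nhdsGT_pos.and
      ((eventually_nhdsGT_lt_of_zero continuous_id rfl hρ).and
      ((eventually_nhdsGT_lt_of_zero
        (f := fun h => Real.exp (5 * b * T) * (h ^ 2 + h ^ 2)) (by fun_prop) (by simp)
        hρ2).and
      (eventually_nhdsGT_lt_of_zero
        (f := fun h => Real.exp (4 * b * (D / a)) * (Real.exp (5 * b * T) * (h ^ 2 + h ^ 2) +
          h * (D + b * h) / (2 * b))) (by fun_prop) (by simp) hρ2)))).exists
  obtain ⟨ε₁, hε₁, hdamp⟩ := exists_damp_eq hb hK hh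
  filter_upwards [self_mem_nhdsWithin, Ioo_mem_nhdsGT hε₁,
    eventually_nhdsGT_lt_of_zero continuous_id rfl one_pos,
    eventually_nhdsGT_lt_of_zero continuous_id rfl hh,
    eventually_nhdsGT_lt_of_zero (f := fun ε => ε * V) (by fun_prop) (by simp) hρ,
    eventually_nhdsGT_lt_of_zero (f := fun ε => b * (ε * V * Real.exp V)) (by fun_prop)
      (by simp) (by positivity : 0 < D / 8)] with ε hε hεm hε1 hεh hεV hεV'
  have hε : 0 < ε := hε
  have hεh : ε ≤ h := le_of_lt hεh
  obtain ⟨η, hη, hηK⟩ := hdamp ε hεm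
  obtain ⟨G, hG⟩ := exists_isCutoff hb hε hη.1 hK hηK
  have hsq : η ^ 2 + ε ^ 2 ≤ h ^ 2 + h ^ 2 :=
    add_le_add (pow_le_pow_left₀ hη.1.le hη.2 2) (pow_le_pow_left₀ hε.le hεh 2)
  have he1 : Real.exp (5 * b * T) * (η ^ 2 + ε ^ 2) ≤
      Real.exp (5 * b * T) * (h ^ 2 + h ^ 2) :=
    mul_le_mul_of_nonneg_left hsq (Real.exp_pos _).le
  have he2 : η * (D + b * ε) / (2 * b) ≤ h * (D + b * h) / (2 * b) := by
    have := hη.1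
    have := hη.2
    gcongr
  exact ⟨V, ρ, η, G, hρδ.le,
    { a_pos := ha
      b_pos := hb
      D_pos := hD
      T_pos := hT
      ε_pos := hε
      ε_le := le_of_lt hε1
      η_pos := hη.1
      η_le := hη.2.trans hhρ.le
      V_nonneg := hV
      ρ_le_a := hρa.le
      ρ_le_D := hρD.le
      ρ_lt := hρl
      εV_le := hεV.le
      εV_exp_le := hεV'.le
      lt_K := by linarith
      cutoff := hG
      isSol := hu
      zero_eq := hu0
      T_eq := huT
      snd_nonpos := hu2
      abs_fst_le := hM1
      abs_snd_le := hM2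
      error_le := he1.trans herr.le
      error_le' := (mul_le_mul_of_nonneg_left (add_le_add he1 he2)
        (Real.exp_pos _).le).trans herr'.le
      damp_eq := hηK
      two_le_exp := hV2
      contract := hVc }⟩

end Corbeiller

/-- The singular cycle `Γ₀ = Γ¹ ∪ Γ²` of the Le Corbeiller system is well defined (the
forward orbit of the tangency point `(0,0)` under the affine system `ẋ = y + a, ẏ = −x + 2by`
returns to `{y = 0}` at a point `x_d < 0`), and the limit cycles `Γ_ε` converge to `Γ₀` in
Hausdorff distance as `ε → 0⁺`. -/
theorem corbeiller_cycle_convergence (a b : ℝ) (ha : 0 < a) (hb : b ∈ Set.Ioo (0 : ℝ) 1)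
    (u : ℝ → ℝ × ℝ)
    (hu : ∀ t : ℝ, HasDerivAt u ((u t).2 + a, -(u t).1 + 2 * b * (u t).2) t)
    (hu0 : u 0 = (0, 0)) :
    ∃ T > (0 : ℝ),
      (u T).2 = 0 ∧
      (∀ t ∈ Set.Ioo (0 : ℝ) T, (u t).2 < 0) ∧
      (u T).1 < 0 ∧
      (∃ R > (0 : ℝ), ∀ r : ℝ, R ≤ r → ∃ ε₀ > (0 : ℝ),
        (∀ ε ∈ Set.Ioo (0 : ℝ) ε₀, ∃ p : ℝ → ℝ × ℝ,
          IsPeriodicSol (corbeillerField a b ε) p ∧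
          Set.range p ⊆ Metric.closedBall (0 : ℝ × ℝ) r ∧
          (∀ q : ℝ → ℝ × ℝ, IsPeriodicSol (corbeillerField a b ε) q →
            Set.range q ⊆ Metric.closedBall (0 : ℝ × ℝ) r → Set.range q = Set.range p)) ∧
        (∀ Γ : ℝ → Set (ℝ × ℝ),
          (∀ ε ∈ Set.Ioo (0 : ℝ) ε₀, ∃ p : ℝ → ℝ × ℝ,
            IsPeriodicSol (corbeillerField a b ε) p ∧
            Set.range p ⊆ Metric.closedBall (0 : ℝ × ℝ) r ∧ Γ ε = Set.range p) →
          Filter.Tendsto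
            (fun ε => Metric.hausdorffDist (Γ ε)
              ((u '' Set.Icc 0 T) ∪ (Set.Icc ((u T).1) 0 ×ˢ ({0} : Set ℝ))))
            (nhdsWithin 0 (Set.Ioi (0 : ℝ))) (nhds 0))) := by
  have hsol : Corbeiller.IsSol a (fun y => 2 * b * y) u := hu
  obtain ⟨T, hT, hT2, hneg, hT1⟩ := Corbeiller.linear_orbit_returns ha hb hsol hu0
  obtain ⟨M, hM⟩ := ((isCompact_Icc (a := (0 : ℝ)) (b := T)).image hsol.continuous).isBounded
    |>.exists_norm_le
  have hM' : ∀ t ∈ Set.Icc 0 T, |(u t).1| ≤ M ∧ |(u t).2| ≤ M := fun t ht =>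
    ⟨(norm_fst_le _).trans (hM _ (Set.mem_image_of_mem u ht)),
      (norm_snd_le _).trans (hM _ (Set.mem_image_of_mem u ht))⟩
  have hMpos : 0 < M := (abs_pos.2 hT1.ne).trans_le (hM' T (Set.right_mem_Icc.2 hT.le)).1
  have hu2 : ∀ t ∈ Set.Icc 0 T, (u t).2 ≤ 0 := fun t ht => by
    rcases ht.1.eq_or_lt with h | h
    · rw [← h, hu0]
    · rcases ht.2.eq_or_lt with h' | h'
      · rw [h', hT2]
      · exact (hneg t ⟨h, h'⟩).le
  refine ⟨T, hT, hT2, hneg, hT1, 2 * M, by linarith, fun r hr => ?_⟩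
  have key : ∀ δ > 0, ∀ᶠ ε in nhdsWithin 0 (Set.Ioi (0 : ℝ)), ∃ p : ℝ → ℝ × ℝ,
      IsPeriodicSol (corbeillerField a b ε) p ∧
      Set.range p ⊆ Metric.closedBall (0 : ℝ × ℝ) r ∧
      (∀ q : ℝ → ℝ × ℝ, IsPeriodicSol (corbeillerField a b ε) q →
        Set.range q ⊆ Metric.closedBall (0 : ℝ × ℝ) r → Set.range q = Set.range p) ∧
      Metric.hausdorffDist (Set.range p)
        ((u '' Set.Icc 0 T) ∪ (Set.Icc ((u T).1) 0 ×ˢ ({0} : Set ℝ))) ≤ δ := fun δ hδ => by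
    have huT : u T = (-(-(u T).1), 0) := Prod.ext (neg_neg _).symm hT2
    filter_upwards [Corbeiller.exists_regime (K := r + 1) ha hb.1 (neg_pos.2 hT1) hT hsol hu0 huT
      hu2 (fun t ht => (hM' t ht).1) (fun t ht => (hM' t ht).2) (by linarith) hδ] with ε hε
    obtain ⟨V, ρ, η, G, hρδ, h⟩ := hε
    obtain ⟨p, hp, hpr, hq, hdist⟩ := h.exists_cycle
    refine ⟨p, hp, hpr.trans (Metric.closedBall_subset_closedBall hr), fun q hqp hqr =>
      hq q hqp fun t => ?_, hdist.trans hρδ⟩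
    have h1 := mem_closedBall_zero_iff.1 (hqr (Set.mem_range_self t))
    have h2 := (abs_le.1 ((norm_fst_le (q t)).trans h1)).1
    linarith
  obtain ⟨ε₀, hε₀, hsub⟩ := mem_nhdsGT_iff_exists_Ioo_subset.1 (key 1 one_pos)
  refine ⟨ε₀, hε₀, fun ε hε => ?_, fun Γ hΓ => ?_⟩
  · obtain ⟨p, hp, hpr, hq, -⟩ := hsub hε
    exact ⟨p, hp, hpr, hq⟩
  · refine Metric.tendsto_nhds.2 fun δ hδ => ?_
    filter_upwards [key (δ / 2) (half_pos hδ), Ioo_mem_nhdsGT hε₀] with ε hε hε'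
    obtain ⟨p, -, -, hq, hdist⟩ := hε
    obtain ⟨q, hqp, hqr, hΓq⟩ := hΓ ε hε'
    rw [hΓq, hq q hqp hqr, Real.dist_eq, sub_zero, abs_of_nonneg Metric.hausdorffDist_nonneg]
    linarith
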